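/- arXiv:1204.1400 — 8 statements merged into one kernel-verified Lean document; each statement's English description precedes it below -/
import Mathlib

section
/- Let r > 0 and y ∈ ℝ² with d := ‖y‖. Then the Lebesgue measure of the lune D(0,r) \ D(y,r) equals π r² when d > 2r, and equals π r² − 2 r² · arcsin(√(1 − d²/(4r²))) + r · d · √(1 − d²/(4r²)) when 0 ≤ d ≤ 2r. -/
open MeasureTheory Real Filter

theorem hasDerivAt_circle_segment {r t : ℝ} (ht : t ∈ Set.Ioo (-r) r) :
    HasDerivAt (fun t => t * √(r ^ 2 - t ^ 2) + r ^ 2 * arcsin (t / r)) (2 * √(r ^ 2 - t ^ 2)) t := by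
  obtain ⟨h1, h2⟩ := ht
  have hr : 0 < r := by linarith
  have hpos : 0 < r ^ 2 - t ^ 2 := by nlinarith
  have hs : 0 < √(r ^ 2 - t ^ 2) := Real.sqrt_pos.2 hpos
  have hsq : √(r ^ 2 - t ^ 2) ^ 2 = r ^ 2 - t ^ 2 := Real.sq_sqrt hpos.le
  have hq : √(1 - (t / r) ^ 2) = √(r ^ 2 - t ^ 2) / r := by
    rw [show 1 - (t / r) ^ 2 = (r ^ 2 - t ^ 2) / r ^ 2 by field_simp, Real.sqrt_div hpos.le,
      Real.sqrt_sq hr.le]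
  have ha : HasDerivAt arcsin (1 / √(1 - (t / r) ^ 2)) (t / r) := by
    apply Real.hasDerivAt_arcsin
    · exact ((lt_div_iff₀ hr).2 (by linarith)).ne'
    · exact ((div_lt_iff₀ hr).2 (by linarith)).ne
  have hb := (ha.comp t ((hasDerivAt_id t).div_const r)).const_mul (r ^ 2)
  have hc : HasDerivAt (fun t => √(r ^ 2 - t ^ 2)) ((-(2 * t)) / (2 * √(r ^ 2 - t ^ 2))) t := by
    refine HasDerivAt.sqrt ?_ hpos.ne'
    simpa using (hasDerivAt_pow 2 t).const_sub (r ^ 2)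
  convert! ((hasDerivAt_id t).mul hc).add hb using 1
  rw [hq]
  simp only [id]
  field_simp
  rw [hsq]
  ring

theorem sq_mul_sqrt_one_sub {r d : ℝ} (hr : 0 < r) (hd : 0 ≤ d) (hdr : d ≤ 2 * r) :
    (r * √(1 - d ^ 2 / (4 * r ^ 2))) ^ 2 = r ^ 2 - (d / 2) ^ 2 := by
  rw [mul_pow, Real.sq_sqrt (sub_nonneg.2 ((div_le_one (by positivity)).2 (by nlinarith)))]
  field_simp
  ring

theorem integral_lens_width {r d : ℝ} (hr : 0 < r) (hd : 0 ≤ d) (hdr : d ≤ 2 * r) :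
    ∫ t in (-(r * √(1 - d ^ 2 / (4 * r ^ 2))))..(r * √(1 - d ^ 2 / (4 * r ^ 2))),
        (2 * √(r ^ 2 - t ^ 2) - d) =
      2 * r ^ 2 * arcsin (√(1 - d ^ 2 / (4 * r ^ 2))) - r * d * √(1 - d ^ 2 / (4 * r ^ 2)) := by
  set q := √(1 - d ^ 2 / (4 * r ^ 2)) with hq
  have hq0 : 0 ≤ q := Real.sqrt_nonneg _
  have hq1 : q ≤ 1 := Real.sqrt_le_one.2 (by linarith [show 0 ≤ d ^ 2 / (4 * r ^ 2) by positivity])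
  have hrq : r * q ≤ r := by nlinarith
  have hend : √(r ^ 2 - (r * q) ^ 2) = d / 2 := by
    rw [hq, sq_mul_sqrt_one_sub hr hd hdr, sub_sub_cancel, Real.sqrt_sq (by positivity)]
  rw [intervalIntegral.integral_eq_sub_of_hasDerivAt_of_le
    (f := fun t => t * √(r ^ 2 - t ^ 2) + r ^ 2 * arcsin (t / r) - d * t)
    (by nlinarith) (by fun_prop)]
  · have h1 : r * q / r = q := by field_simp
    have h2 : -(r * q) / r = -q := by field_simp
    simp only [neg_sq, hend, h1, h2, arcsin_neg]
    ring
  · intro t ht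
    have := hasDerivAt_circle_segment (r := r) (t := t) ⟨by linarith [ht.1], by linarith [ht.2]⟩
    convert! this.sub ((hasDerivAt_id t).const_mul d) using 1
    ring
  · exact Continuous.intervalIntegrable (by fun_prop) _ _

theorem lens_width_nonneg {r d t : ℝ} (hr : 0 < r) (hd : 0 ≤ d) (hdr : d ≤ 2 * r)
    (ht : t ∈ Set.Icc (-(r * √(1 - d ^ 2 / (4 * r ^ 2)))) (r * √(1 - d ^ 2 / (4 * r ^ 2)))) :
    0 ≤ 2 * √(r ^ 2 - t ^ 2) - d := by
  have hsq := sq_mul_sqrt_one_sub hr hd hdr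
  have h : d / 2 ≤ √(r ^ 2 - t ^ 2) := Real.le_sqrt_of_sq_le (by nlinarith [ht.1, ht.2])
  linarith

theorem lintegral_lens_width {r d : ℝ} (hr : 0 < r) (hd : 0 ≤ d) (hdr : d ≤ 2 * r) :
    ∫⁻ t : ℝ, ENNReal.ofReal (2 * √(r ^ 2 - t ^ 2) - d) =
      ENNReal.ofReal (∫ t in (-(r * √(1 - d ^ 2 / (4 * r ^ 2))))..
        (r * √(1 - d ^ 2 / (4 * r ^ 2))), (2 * √(r ^ 2 - t ^ 2) - d)) := by
  set q := √(1 - d ^ 2 / (4 * r ^ 2)) with hq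
  have hq0 : 0 ≤ q := Real.sqrt_nonneg _
  have hq2 : (r * q) ^ 2 = r ^ 2 - (d / 2) ^ 2 := sq_mul_sqrt_one_sub hr hd hdr
  rw [intervalIntegral.integral_of_le (by nlinarith), ← integral_Icc_eq_integral_Ioc,
    ofReal_integral_eq_lintegral_ofReal
      ((by fun_prop : Continuous fun t => 2 * √(r ^ 2 - t ^ 2) - d).integrableOn_Icc)
      ((ae_restrict_iff' measurableSet_Icc).2 (Eventually.of_forall
        fun t => lens_width_nonneg hr hd hdr)),
    setLIntegral_eq_of_support_subset]
  intro t ht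
  have h : d / 2 < √(r ^ 2 - t ^ 2) := by
    have := ENNReal.ofReal_pos.1 (pos_iff_ne_zero.2 ht)
    linarith
  have h' := (Real.lt_sqrt (by positivity)).1 h
  exact abs_le.1 (abs_le_of_sq_le_sq (by linarith) (by positivity))

theorem volume_setOf_sq_add_sq_le {r d : ℝ} (hd : 0 ≤ d) (t : ℝ) :
    volume {x : ℝ | x ^ 2 + t ^ 2 ≤ r ^ 2 ∧ (x - d) ^ 2 + t ^ 2 ≤ r ^ 2} =
      ENNReal.ofReal (2 * √(r ^ 2 - t ^ 2) - d) := by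
  rcases lt_or_ge (r ^ 2) (t ^ 2) with h | h
  · rw [Real.sqrt_eq_zero_of_nonpos (by linarith), ENNReal.ofReal_of_nonpos (by linarith)]
    have : {x : ℝ | x ^ 2 + t ^ 2 ≤ r ^ 2 ∧ (x - d) ^ 2 + t ^ 2 ≤ r ^ 2} = ∅ :=
      Set.eq_empty_of_forall_notMem fun x hx => by nlinarith [hx.1, sq_nonneg x]
    rw [this, measure_empty]
  · have key : ∀ x : ℝ, x ^ 2 + t ^ 2 ≤ r ^ 2 ↔ |x| ≤ √(r ^ 2 - t ^ 2) := by
      intro x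
      rw [← Real.sqrt_sq_eq_abs, Real.sqrt_le_sqrt_iff (by linarith), le_sub_iff_add_le]
    have : {x : ℝ | x ^ 2 + t ^ 2 ≤ r ^ 2 ∧ (x - d) ^ 2 + t ^ 2 ≤ r ^ 2} =
        Set.Icc (d - √(r ^ 2 - t ^ 2)) (√(r ^ 2 - t ^ 2)) := by
      ext x
      simp only [Set.mem_ofPred_eq, key, Set.mem_Icc, abs_le]
      constructor
      · rintro ⟨⟨_, _⟩, _, _⟩
        constructor <;> linarith
      · rintro ⟨_, _⟩
        refine ⟨⟨?_, ?_⟩, ?_, ?_⟩ <;> linarith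
    rw [this, Real.volume_Icc]
    congr 1
    ring

theorem volume_closedBall_inter_closedBall_single {r d : ℝ} (hr : 0 < r) (hd : 0 ≤ d) :
    volume (Metric.closedBall (0 : EuclideanSpace ℝ (Fin 2)) r ∩ Metric.closedBall !₂[d, 0] r) =
      ∫⁻ t : ℝ, ENNReal.ofReal (2 * √(r ^ 2 - t ^ 2) - d) := by
  let A : Set (ℝ × ℝ) :=
    {p | p.1 ^ 2 + p.2 ^ 2 ≤ r ^ 2 ∧ (p.1 - d) ^ 2 + p.2 ^ 2 ≤ r ^ 2}
  have hA : MeasurableSet A := by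
    refine MeasurableSet.inter (s₁ := {p : ℝ × ℝ | p.1 ^ 2 + p.2 ^ 2 ≤ r ^ 2})
      (s₂ := {p : ℝ × ℝ | (p.1 - d) ^ 2 + p.2 ^ 2 ≤ r ^ 2}) ?_ ?_ <;>
    exact measurableSet_le (by fun_prop) (by fun_prop)
  have hmp := (volume_preserving_finTwoArrow ℝ).comp (PiLp.volume_preserving_ofLp (Fin 2))
  have hpre : Metric.closedBall (0 : EuclideanSpace ℝ (Fin 2)) r ∩ Metric.closedBall !₂[d, 0] r =
      (MeasurableEquiv.finTwoArrow ∘ WithLp.ofLp) ⁻¹' A := by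
    ext x
    simp [A, EuclideanSpace.dist_eq, Real.sqrt_le_left hr.le, EuclideanSpace.norm_eq,
      Real.dist_eq, MeasurableEquiv.finTwoArrow, Fin.sum_univ_two, sq_abs]
  rw [hpre, hmp.measure_preimage hA.nullMeasurableSet, Measure.volume_eq_prod,
    Measure.prod_apply_symm hA]
  exact lintegral_congr fun t => volume_setOf_sq_add_sq_le hd t

theorem volume_closedBall_inter_closedBall {r : ℝ} (hr : 0 < r) (y : EuclideanSpace ℝ (Fin 2)) :
    volume (Metric.closedBall (0 : EuclideanSpace ℝ (Fin 2)) r ∩ Metric.closedBall y r) =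
      ∫⁻ t : ℝ, ENNReal.ofReal (2 * √(r ^ 2 - t ^ 2) - ‖y‖) := by
  rw [← volume_closedBall_inter_closedBall_single hr (norm_nonneg y)]
  have hnorm : ‖y‖ = ‖(!₂[‖y‖, 0] : EuclideanSpace ℝ (Fin 2))‖ := by
    simp [EuclideanSpace.norm_eq (!₂[‖y‖, 0] : EuclideanSpace ℝ (Fin 2))]
  let R := Submodule.reflection (ℝ ∙ (y - !₂[‖y‖, 0]))ᗮ
  have hR : R y = !₂[‖y‖, 0] := Submodule.reflection_sub hnorm
  have hpre : R ⁻¹' (Metric.closedBall 0 r ∩ Metric.closedBall !₂[‖y‖, 0] r) =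
      Metric.closedBall 0 r ∩ Metric.closedBall y r := by
    rw [Set.preimage_inter, ← hR, R.isometry.preimage_closedBall]
    conv_lhs => rw [← map_zero R, R.isometry.preimage_closedBall]
  rw [← hpre]
  exact R.measurePreserving.measure_preimage
    (Metric.isClosed_closedBall.inter Metric.isClosed_closedBall).measurableSet.nullMeasurableSet

/-- the Lebesgue measure of the lune `D(0,r) \ D(y,r)` in `ℝ²`,
with `d := ‖y‖`, equals `π r²` when `d > 2r`, and equals
`π r² − 2 r² arcsin(√(1 − d²/(4r²))) + r d √(1 − d²/(4r²))` when `0 ≤ d ≤ 2r`. -/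
theorem volume_lune (r : ℝ) (hr : 0 < r) (y : EuclideanSpace ℝ (Fin 2)) :
    (2 * r < ‖y‖ →
      volume (Metric.closedBall (0 : EuclideanSpace ℝ (Fin 2)) r \ Metric.closedBall y r)
        = ENNReal.ofReal (π * r ^ 2)) ∧
    (‖y‖ ≤ 2 * r →
      volume (Metric.closedBall (0 : EuclideanSpace ℝ (Fin 2)) r \ Metric.closedBall y r)
        = ENNReal.ofReal (π * r ^ 2
            - 2 * r ^ 2 * Real.arcsin (Real.sqrt (1 - ‖y‖ ^ 2 / (4 * r ^ 2)))
            + r * ‖y‖ * Real.sqrt (1 - ‖y‖ ^ 2 / (4 * r ^ 2)))) := by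
  have hball : volume (Metric.closedBall (0 : EuclideanSpace ℝ (Fin 2)) r) =
      ENNReal.ofReal (π * r ^ 2) := by
    rw [EuclideanSpace.volume_closedBall_fin_two, ← ENNReal.ofReal_pow hr.le,
      ← ENNReal.ofReal_mul (by positivity), mul_comm]
  refine ⟨fun h => ?_, fun h => ?_⟩
  · rw [(Metric.closedBall_disjoint_closedBall (by simpa [two_mul] using h)).sdiff_eq_left, hball]
  · have hlens : volume (Metric.closedBall (0 : EuclideanSpace ℝ (Fin 2)) r ∩
        Metric.closedBall y r) = ENNReal.ofReal _ :=
      (volume_closedBall_inter_closedBall hr y).trans (lintegral_lens_width hr (norm_nonneg y) h)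
    have hnonneg := intervalIntegral.integral_nonneg (μ := volume)
      (neg_le_self (by positivity : 0 ≤ r * √(1 - ‖y‖ ^ 2 / (4 * r ^ 2))))
      fun t ht => lens_width_nonneg hr (norm_nonneg y) h ht
    rw [integral_lens_width hr (norm_nonneg y) h] at hlens hnonneg
    rw [← Set.sdiff_inter_self_eq_sdiff, Set.inter_comm, measure_sdiff Set.inter_subset_left
      (Metric.isClosed_closedBall.inter
        Metric.isClosed_closedBall).measurableSet.nullMeasurableSet
      (hlens ▸ ENNReal.ofReal_ne_top), hball, hlens, ← ENNReal.ofReal_sub _ hnonneg]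
    congr 1
    ring
end

section
/- Let r > 0 and y ∈ ℝ². If ‖y‖ ≤ r then μ(D(0,r) \ D(y,r)) ≥ √3 · r · ‖y‖, and if ‖y‖ > r then μ(D(0,r) \ D(y,r)) ≥ (π/3 + √3/2) · r². -/
open MeasureTheory Real Filter

/-- In the plane, some measure preserving map onto coordinates `ℝ × ℝ` sends `y` to `(0, ‖y‖)` and
satisfies Pythagoras for the distances to `0` and to `y`. -/
theorem exists_measurePreserving_coordinates (y : EuclideanSpace ℝ (Fin 2)) (hy : y ≠ 0) :
    ∃ Φ : EuclideanSpace ℝ (Fin 2) → ℝ × ℝ, MeasurePreserving Φ ∧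
      (∀ p, ‖p‖ ^ 2 = (Φ p).2 ^ 2 + (Φ p).1 ^ 2) ∧
      ∀ p, dist p y ^ 2 = ((Φ p).2 - ‖y‖) ^ 2 + (Φ p).1 ^ 2 := by
  have hy0 : ‖y‖ ≠ 0 := norm_ne_zero_iff.mpr hy
  let v : Fin 2 → EuclideanSpace ℝ (Fin 2) := fun _ => ‖y‖⁻¹ • y
  have hv : Orthonormal ℝ (({0} : Set (Fin 2)).domRestrict v) := by
    refine ⟨fun i => ?_, fun i j hij => (hij (Subsingleton.elim i j)).elim⟩
    simp [v, Set.domRestrict, norm_smul, hy0]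
  obtain ⟨b, hb⟩ := hv.exists_orthonormalBasis_extension_of_card_eq (by simp)
  have hby : y = ‖y‖ • b 0 := by
    rw [hb 0 rfl, smul_smul, mul_inv_cancel₀ hy0, one_smul]
  have hy_repr : b.repr y = ‖y‖ • EuclideanSpace.single 0 1 := by
    conv_lhs => rw [hby]
    rw [map_smul, b.repr_self]
  refine ⟨fun p => (b.repr p 1, b.repr p 0), ?_, fun p => ?_, fun p => ?_⟩
  · exact Measure.measurePreserving_swap.comp ((volume_preserving_finTwoArrow ℝ).comp
      ((PiLp.volume_preserving_ofLp (Fin 2)).comp b.measurePreserving_repr))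
  · rw [← b.repr.norm_map, EuclideanSpace.norm_sq_eq]
    simp
  · rw [dist_eq_norm, ← b.repr.norm_map, EuclideanSpace.norm_sq_eq, map_sub, hy_repr]
    simp

/-- The lune contains, at each height `s`, a horizontal slice of length
`min u (2 * √(r ^ 2 - s ^ 2))`. -/
theorem ofReal_integral_min_le_volume_lune {r u : ℝ} (hr : 0 < r) {y : EuclideanSpace ℝ (Fin 2)}
    (hy : y ≠ 0) (hu : 0 ≤ u) (huy : u ≤ ‖y‖) :
    ENNReal.ofReal (∫ s in (-r)..r, min u (2 * √(r ^ 2 - s ^ 2))) ≤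
      volume (Metric.closedBall (0 : EuclideanSpace ℝ (Fin 2)) r \ Metric.closedBall y r) := by
  obtain ⟨Φ, hΦ, h0, h1⟩ := exists_measurePreserving_coordinates y hy
  let f : ℝ → ℝ := fun s => -√(r ^ 2 - s ^ 2)
  let g : ℝ → ℝ := fun s => f s + min u (2 * √(r ^ 2 - s ^ 2))
  have hf : Measurable f := by fun_prop
  have hg : Measurable g := by fun_prop
  have hcont : Continuous fun s : ℝ => min u (2 * √(r ^ 2 - s ^ 2)) := by fun_prop
  have hvol : volume (Φ ⁻¹' regionBetween f g (Set.Ioc (-r) r)) =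
      ENNReal.ofReal (∫ s in (-r)..r, min u (2 * √(r ^ 2 - s ^ 2))) := by
    rw [hΦ.measure_preimage
        (measurableSet_regionBetween hf hg measurableSet_Ioc).nullMeasurableSet,
      Measure.volume_eq_prod, volume_regionBetween_eq_lintegral' hf hg measurableSet_Ioc,
      intervalIntegral.integral_of_le (by linarith),
      ofReal_integral_eq_lintegral_ofReal (hcont.integrableOn_Ioc)
        (Eventually.of_forall fun s => by positivity)]
    simp [g]
  rw [← hvol]
  refine measure_mono fun p hp => ?_
  obtain ⟨⟨hs₁, hs₂⟩, hx₁, hx₂⟩ := hp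
  have hw := Real.sq_sqrt (show 0 ≤ r ^ 2 - (Φ p).1 ^ 2 by nlinarith)
  have hw0 := Real.sqrt_nonneg (r ^ 2 - (Φ p).1 ^ 2)
  have hmin₁ := min_le_left u (2 * √(r ^ 2 - (Φ p).1 ^ 2))
  have hmin₂ := min_le_right u (2 * √(r ^ 2 - (Φ p).1 ^ 2))
  simp only [f, g] at hx₁ hx₂
  constructor
  · rw [mem_closedBall_zero_iff]
    refine le_of_sq_le_sq ?_ hr.le
    rw [h0]
    nlinarith
  · rw [Metric.mem_closedBall, not_le]
    refine lt_of_pow_lt_pow_left₀ 2 dist_nonneg ?_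
    rw [h1]
    nlinarith

theorem integral_two_mul_sqrt_sq_sub_sq {r a b : ℝ} (hr : 0 < r) (ha : -r ≤ a) (hab : a ≤ b)
    (hb : b ≤ r) :
    ∫ s in a..b, 2 * √(r ^ 2 - s ^ 2) =
      (b * √(r ^ 2 - b ^ 2) + r ^ 2 * arcsin (b / r)) -
        (a * √(r ^ 2 - a ^ 2) + r ^ 2 * arcsin (a / r)) := by
  refine intervalIntegral.integral_eq_sub_of_hasDerivAt_of_le
    (f := fun s => s * √(r ^ 2 - s ^ 2) + r ^ 2 * arcsin (s / r)) hab
    (by fun_prop) (fun s hs => ?_) (Continuous.intervalIntegrable (by fun_prop) _ _)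
  have hsr : 0 < r ^ 2 - s ^ 2 := by nlinarith [hs.1, hs.2]
  have h1 : s / r ≠ -1 := by
    rw [Ne, div_eq_iff hr.ne']; linarith [hs.1]
  have h2 : s / r ≠ 1 := by
    rw [Ne, div_eq_iff hr.ne']; linarith [hs.2]
  have hd1 : HasDerivAt (fun s => r ^ 2 - s ^ 2) (-(2 * s)) s := by
    simpa using (hasDerivAt_pow 2 s).const_sub (r ^ 2)
  have hd2 := (hasDerivAt_id s).mul (hd1.sqrt hsr.ne')
  have hd3 := ((hasDerivAt_arcsin h1 h2).comp s ((hasDerivAt_id s).div_const r)).const_mul (r ^ 2)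
  refine (hd2.add hd3).congr_deriv ?_
  have hs1 : √(1 - (s / r) ^ 2) = √(r ^ 2 - s ^ 2) / r := by
    rw [show 1 - (s / r) ^ 2 = (r ^ 2 - s ^ 2) / r ^ 2 by field_simp,
      Real.sqrt_div hsr.le, Real.sqrt_sq hr.le]
  have hw := Real.sq_sqrt hsr.le
  have hw0 := (Real.sqrt_pos.mpr hsr).ne'
  simp only [id, hs1]
  field_simp
  linear_combination (-1) * hw

theorem arcsin_sqrt_three_div_two : arcsin (√3 / 2) = π / 3 := by
  rw [← Real.sin_pi_div_three]
  exact arcsin_sin (by linarith [pi_pos]) (by linarith [pi_pos])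

theorem sqrt_three_div_two_mul_le {r : ℝ} (hr : 0 ≤ r) : √3 / 2 * r ≤ r := by
  have : √3 ≤ 2 := Real.sqrt_le_iff.mpr ⟨by norm_num, by norm_num⟩
  nlinarith

theorem sq_sub_sqrt_three_div_two_mul_sq (r : ℝ) : r ^ 2 - (√3 / 2 * r) ^ 2 = (r / 2) ^ 2 := by
  rw [mul_pow, div_pow, Real.sq_sqrt (by norm_num)]
  ring

theorem integral_min_two_mul_sqrt_sq_sub_sq_central {r t : ℝ} (hr : 0 ≤ r) (htr : t ≤ r) :
    ∫ s in (-(√3 / 2 * r))..(√3 / 2 * r), min t (2 * √(r ^ 2 - s ^ 2)) = √3 * r * t := by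
  have ha0 : 0 ≤ √3 / 2 * r := by positivity
  have ha2 := sq_sub_sqrt_three_div_two_mul_sq r
  rw [intervalIntegral.integral_congr (g := fun _ => t)]
  · rw [intervalIntegral.integral_const, smul_eq_mul]; ring
  · intro s hs
    rw [Set.uIcc_of_le (by linarith)] at hs
    refine min_eq_left ?_
    have : r / 2 ≤ √(r ^ 2 - s ^ 2) :=
      Real.le_sqrt_of_sq_le (by nlinarith [hs.1, hs.2])
    linarith

theorem integral_min_two_mul_sqrt_sq_sub_sq {r : ℝ} (hr : 0 < r) :
    ∫ s in (-r)..r, min r (2 * √(r ^ 2 - s ^ 2)) = (π / 3 + √3 / 2) * r ^ 2 := by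
  set a : ℝ := √3 / 2 * r with ha
  have ha0 : 0 ≤ a := by positivity
  have har : a ≤ r := sqrt_three_div_two_mul_le hr.le
  have ha2 : r ^ 2 - a ^ 2 = (r / 2) ^ 2 := sq_sub_sqrt_three_div_two_mul_sq r
  have hint (c d : ℝ) : IntervalIntegrable (fun s => min r (2 * √(r ^ 2 - s ^ 2))) volume c d :=
    Continuous.intervalIntegrable (by fun_prop) _ _
  have hmid : ∫ s in (-a)..a, min r (2 * √(r ^ 2 - s ^ 2)) = √3 * r * r :=
    integral_min_two_mul_sqrt_sq_sub_sq_central hr.le le_rfl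
  have hright : ∫ s in a..r, min r (2 * √(r ^ 2 - s ^ 2)) = (π / 6 - √3 / 4) * r ^ 2 := by
    rw [intervalIntegral.integral_congr (g := fun s => 2 * √(r ^ 2 - s ^ 2))]
    · rw [integral_two_mul_sqrt_sq_sub_sq hr (by linarith) har le_rfl, ha2,
        Real.sqrt_sq (by positivity), div_self hr.ne', ha, mul_div_cancel_right₀ _ hr.ne',
        arcsin_sqrt_three_div_two, arcsin_one]
      simp only [sub_self, Real.sqrt_zero]
      ring
    · intro s hs
      rw [Set.uIcc_of_le har] at hs
      refine min_eq_right ?_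
      have : √(r ^ 2 - s ^ 2) ≤ r / 2 :=
        Real.sqrt_le_iff.mpr ⟨by positivity, by nlinarith [hs.1, hs.2]⟩
      linarith
  have hleft : ∫ s in (-r)..(-a), min r (2 * √(r ^ 2 - s ^ 2)) = (π / 6 - √3 / 4) * r ^ 2 := by
    rw [← hright, ← intervalIntegral.integral_comp_neg]
    simp only [neg_sq]
  rw [← intervalIntegral.integral_add_adjacent_intervals (hint (-r) (-a)) (hint (-a) r),
    ← intervalIntegral.integral_add_adjacent_intervals (hint (-a) a) (hint a r),
    hleft, hmid, hright]
  ring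

theorem sqrt_three_mul_mul_le_integral_min {r t : ℝ} (ht : 0 ≤ t) (htr : t ≤ r) :
    √3 * r * t ≤ ∫ s in (-r)..r, min t (2 * √(r ^ 2 - s ^ 2)) := by
  have hr : 0 ≤ r := ht.trans htr
  have ha0 : 0 ≤ √3 / 2 * r := by positivity
  have har := sqrt_three_div_two_mul_le hr
  rw [← integral_min_two_mul_sqrt_sq_sub_sq_central hr htr]
  exact intervalIntegral.integral_mono_interval (by linarith) (by linarith) har
    (Eventually.of_forall fun s => le_min ht (by positivity))
    (Continuous.intervalIntegrable (by fun_prop) _ _)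

/-- lower bounds on the Lebesgue measure of the lune
`D(0,r) \ D(y,r)`: if `‖y‖ ≤ r` it is at least `√3 · r · ‖y‖`, and if
`‖y‖ > r` it is at least `(π/3 + √3/2) · r²`. -/
theorem volume_lune_lower_bounds (r : ℝ) (hr : 0 < r) (y : EuclideanSpace ℝ (Fin 2)) :
    (‖y‖ ≤ r →
      ENNReal.ofReal (Real.sqrt 3 * r * ‖y‖) ≤
        volume (Metric.closedBall (0 : EuclideanSpace ℝ (Fin 2)) r \ Metric.closedBall y r)) ∧
    (r < ‖y‖ →
      ENNReal.ofReal ((π / 3 + Real.sqrt 3 / 2) * r ^ 2) ≤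
        volume (Metric.closedBall (0 : EuclideanSpace ℝ (Fin 2)) r \ Metric.closedBall y r)) := by
  refine ⟨fun h => ?_, fun h => ?_⟩
  · rcases eq_or_ne y 0 with rfl | hy
    · simp
    · exact (ENNReal.ofReal_le_ofReal
        (sqrt_three_mul_mul_le_integral_min (norm_nonneg y) h)).trans
        (ofReal_integral_min_le_volume_lune hr hy (norm_nonneg y) le_rfl)
  · rw [← integral_min_two_mul_sqrt_sq_sub_sq hr]
    exact ofReal_integral_min_le_volume_lune hr (norm_pos_iff.mp (hr.trans h)) hr.le h.le
end

section
/- Let g : [0,∞) → [0,1] be non-increasing with C := ∫_{ℝ²} g(‖x‖) dx satisfying 0 < C < ∞, and let r > 0. Then for every y ∈ ℝ², ∫_{ℝ²} g(‖x‖) · g(‖x − y‖) dx ≤ C − g(r⁻) · (1 − g(r⁺)) · μ(D(0,r) \ D(y,r)), where g(r⁻) and g(r⁺) are the left- and right-hand limits of g at r. -/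
open MeasureTheory Real Filter

theorem antitone_comp_max_of_antitoneOn {g : ℝ → ℝ} (hg : AntitoneOn g (Set.Ici (0 : ℝ))) :
    Antitone fun t => g (max 0 t) := fun _ _ hab =>
  hg (Set.mem_Ici.2 (le_max_left _ _)) (Set.mem_Ici.2 (le_max_left _ _)) (max_le_max le_rfl hab)

theorem AntitoneOn.tendsto_leftLim_of_pos {g : ℝ → ℝ} (hg : AntitoneOn g (Set.Ici (0 : ℝ)))
    {r : ℝ} (hr : 0 < r) :
    Tendsto g (nhdsWithin r (Set.Iio r)) (nhds (Function.leftLim g r)) := by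
  have key : Tendsto g (nhdsWithin r (Set.Iio r))
      (nhds (Function.leftLim (fun t => g (max 0 t)) r)) := by
    refine ((antitone_comp_max_of_antitoneOn hg).tendsto_leftLim r).congr' ?_
    filter_upwards [mem_nhdsWithin_of_mem_nhds (Ioi_mem_nhds hr)] with t ht
    rw [max_eq_right (le_of_lt ht)]
  rwa [leftLim_eq_of_tendsto key]

theorem AntitoneOn.tendsto_rightLim_of_pos {g : ℝ → ℝ} (hg : AntitoneOn g (Set.Ici (0 : ℝ)))
    {r : ℝ} (hr : 0 < r) :
    Tendsto g (nhdsWithin r (Set.Ioi r)) (nhds (Function.rightLim g r)) := by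
  have key : Tendsto g (nhdsWithin r (Set.Ioi r))
      (nhds (Function.rightLim (fun t => g (max 0 t)) r)) := by
    refine ((antitone_comp_max_of_antitoneOn hg).tendsto_rightLim r).congr' ?_
    filter_upwards [self_mem_nhdsWithin] with t ht
    rw [max_eq_right (hr.trans ht).le]
  rwa [rightLim_eq_of_tendsto key]

theorem AntitoneOn.leftLim_le_of_lt {g : ℝ → ℝ} (hg : AntitoneOn g (Set.Ici (0 : ℝ)))
    {s r : ℝ} (hs : 0 ≤ s) (hsr : s < r) : Function.leftLim g r ≤ g s := by
  refine le_of_tendsto (hg.tendsto_leftLim_of_pos (hs.trans_lt hsr)) ?_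
  filter_upwards [mem_nhdsWithin_of_mem_nhds (Ioi_mem_nhds hsr)] with t ht
  exact hg hs (hs.trans (le_of_lt ht)) (le_of_lt ht)

theorem AntitoneOn.le_rightLim_of_lt {g : ℝ → ℝ} (hg : AntitoneOn g (Set.Ici (0 : ℝ)))
    {r s : ℝ} (hr : 0 < r) (hrs : r < s) : g s ≤ Function.rightLim g r := by
  refine ge_of_tendsto (hg.tendsto_rightLim_of_pos hr) ?_
  filter_upwards [self_mem_nhdsWithin, mem_nhdsWithin_of_mem_nhds (Iio_mem_nhds hrs)]
    with t ht hts
  exact hg (hr.trans ht).le (hr.trans hrs).le (le_of_lt hts)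

/-- for non-increasing `g : [0,∞) → [0,1]` with
`C := ∫_{ℝ²} g(‖x‖) dx ∈ (0,∞)` and any `r > 0`, for every `y ∈ ℝ²`,
`∫_{ℝ²} g(‖x‖) g(‖x − y‖) dx ≤ C − g(r⁻)(1 − g(r⁺)) · μ(D(0,r) \ D(y,r))`. -/
theorem correlation_integral_le
    (g : ℝ → ℝ)
    (hmono : AntitoneOn g (Set.Ici (0 : ℝ)))
    (hrange : ∀ x ∈ Set.Ici (0 : ℝ), g x ∈ Set.Icc (0 : ℝ) 1)
    (hint : Integrable (fun x : EuclideanSpace ℝ (Fin 2) => g ‖x‖))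
    (hpos : 0 < ∫ x : EuclideanSpace ℝ (Fin 2), g ‖x‖)
    (r : ℝ) (hr : 0 < r) (y : EuclideanSpace ℝ (Fin 2)) :
    ∫ x : EuclideanSpace ℝ (Fin 2), g ‖x‖ * g ‖x - y‖ ≤
      (∫ x : EuclideanSpace ℝ (Fin 2), g ‖x‖)
        - Function.leftLim g r * (1 - Function.rightLim g r) *
          (volume (Metric.closedBall (0 : EuclideanSpace ℝ (Fin 2)) r
            \ Metric.closedBall y r)).toReal := by
  set S := Metric.closedBall (0 : EuclideanSpace ℝ (Fin 2)) r \ Metric.closedBall y r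
  have hS : MeasurableSet S := measurableSet_closedBall.diff measurableSet_closedBall
  have hSfin : volume S ≠ ⊤ :=
    measure_ne_top_of_subset Set.sdiff_subset measure_closedBall_lt_top.ne
  have hshift : Measurable fun x : EuclideanSpace ℝ (Fin 2) => g ‖x - y‖ := by
    have h := (antitone_comp_max_of_antitoneOn hmono).measurable.comp
      (measurable_id.sub_const y).norm
    simpa [Function.comp_def] using h
  have hprod : Integrable fun x : EuclideanSpace ℝ (Fin 2) => g ‖x‖ * g ‖x - y‖ := by
    refine hint.mono (hint.aestronglyMeasurable.mul hshift.aestronglyMeasurable) ?_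
    refine Eventually.of_forall fun x => ?_
    have h := hrange ‖x - y‖ (norm_nonneg _)
    rw [norm_mul]
    refine mul_le_of_le_one_right (norm_nonneg _) ?_
    rw [Real.norm_of_nonneg h.1]
    exact h.2
  have hsphere : ∀ᵐ x : EuclideanSpace ℝ (Fin 2), x ∉ Metric.sphere 0 r :=
    measure_eq_zero_iff_ae_notMem.1 (Measure.addHaar_sphere _ _ _)
  have hle : ∫ x, S.indicator
        (fun _ => Function.leftLim g r * (1 - Function.rightLim g r)) x ≤
      ∫ x : EuclideanSpace ℝ (Fin 2), (g ‖x‖ - g ‖x‖ * g ‖x - y‖) := by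
    refine integral_mono_ae ((integrable_indicator_iff hS).2 (integrableOn_const hSfin))
      (hint.sub hprod) ?_
    filter_upwards [hsphere] with x hx
    have h₁ := hrange ‖x‖ (norm_nonneg _)
    have h₂ := hrange ‖x - y‖ (norm_nonneg _)
    rw [← mul_one_sub]
    by_cases hxS : x ∈ S
    · rw [Set.indicator_of_mem hxS]
      have hxr : ‖x‖ < r :=
        lt_of_le_of_ne (by simpa using hxS.1) (by simpa using hx)
      have hyr : r < ‖x - y‖ := by simpa [dist_eq_norm] using hxS.2
      have hright : Function.rightLim g r ≤ 1 := by
        refine le_of_tendsto (hmono.tendsto_rightLim_of_pos hr) ?_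
        filter_upwards [self_mem_nhdsWithin] with t ht
        exact (hrange t (hr.trans ht).le).2
      exact mul_le_mul (hmono.leftLim_le_of_lt (norm_nonneg _) hxr)
        (sub_le_sub_left (hmono.le_rightLim_of_lt hr hyr) 1) (sub_nonneg.2 hright) h₁.1
    · rw [Set.indicator_of_notMem hxS]
      exact mul_nonneg h₁.1 (sub_nonneg.2 h₂.2)
  rw [integral_sub hint hprod, integral_indicator_const _ hS, smul_eq_mul, Measure.real,
    mul_comm] at hle
  linarith
end

section
/- Let g : [0,∞) → [0,1] be non-increasing with C := ∫_{ℝ²} g(‖x‖) dx satisfying 0 < C < ∞, and let b ∈ ℝ. Then there exists ε₀ ∈ (0, 1/2) such that for every ε ∈ (0, ε₀): lim_{ρ→∞} (λ_ρ/ρ) · ∫_{D(0, 2 r_ρ^{−ε})} exp(λ_ρ · ∫_{ℝ²} g(‖x‖) g(‖x − y‖) dx) dy = 0, where λ_ρ := (log ρ + b)/C and r_ρ := √((log ρ + b)/(C ρ)). -/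
open MeasureTheory Real Filter

/-- The autocorrelation `z ↦ ∫ f x * f (x - z)` of a `[0,1]`-valued integrable function: its deficit
from `∫ f` is subadditive. -/
theorem autocorrelation_add_le {G : Type*} [AddCommGroup G] [MeasurableSpace G] [MeasurableAdd G]
    [MeasurableNeg G] {μ : Measure G} [μ.IsAddRightInvariant] {f : G → ℝ}
    (hf : Integrable f μ) (h0 : ∀ x, 0 ≤ f x) (h1 : ∀ x, f x ≤ 1) (y z : G) :
    (∫ x, f x * f (x - y) ∂μ) + ∫ x, f x * f (x - z) ∂μ
      ≤ (∫ x, f x ∂μ) + ∫ x, f x * f (x - (y + z)) ∂μ := by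
  have hb : ∀ w : G, ∀ᵐ x ∂μ, ‖f (x - w)‖ ≤ 1 := fun w => Eventually.of_forall fun x => by
    rw [Real.norm_of_nonneg (h0 _)]; exact h1 _
  have hsub : ∀ w : G, Integrable (fun x => f (x - w)) μ := fun w => hf.comp_sub_right w
  have hmul : ∀ w : G, Integrable (fun x => f x * f (x - w)) μ := fun w =>
    hf.mul_bdd (hsub w).aestronglyMeasurable (hb w)
  have hz : ∫ x, f x * f (x - z) ∂μ = ∫ x, f (x - y) * f (x - (y + z)) ∂μ := by
    rw [← integral_sub_right_eq_self (fun x => f x * f (x - z)) y]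
    simp only [sub_sub]
  have hC : ∫ x, f x ∂μ = ∫ x, f (x - y) ∂μ := (integral_sub_right_eq_self f y).symm
  have hmul' : Integrable (fun x => f (x - y) * f (x - (y + z))) μ :=
    (hsub y).mul_bdd (hsub _).aestronglyMeasurable (hb _)
  rw [hz, hC, ← integral_add (hmul y) hmul', ← integral_add (hsub y) (hmul _)]
  refine integral_mono ((hmul y).add hmul') ((hsub y).add (hmul _)) fun x => ?_
  have a0 := h0 x
  have a1 := h1 x
  have b0 := h0 (x - y)
  have b1 := h1 (x - y)
  have c0 := h0 (x - (y + z))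
  have c1 := h1 (x - (y + z))
  simp only
  nlinarith [mul_nonneg (mul_nonneg b0 (sub_nonneg.2 a1)) (sub_nonneg.2 c1),
    mul_nonneg (mul_nonneg a0 (sub_nonneg.2 b1)) c0]

theorem autocorrelation_nsmul_le {G : Type*} [AddCommGroup G] [MeasurableSpace G] [MeasurableAdd G]
    [MeasurableNeg G] {μ : Measure G} [μ.IsAddRightInvariant] {f : G → ℝ}
    (hf : Integrable f μ) (h0 : ∀ x, 0 ≤ f x) (h1 : ∀ x, f x ≤ 1) (y : G) (n : ℕ) :
    (∫ x, f x ∂μ) - ∫ x, f x * f (x - (n + 1) • y) ∂μ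
      ≤ (n + 1) * ((∫ x, f x ∂μ) - ∫ x, f x * f (x - y) ∂μ) := by
  induction n with
  | zero => simp
  | succ n ih =>
    have := autocorrelation_add_le hf h0 h1 ((n + 1) • y) y
    rw [← succ_nsmul] at this
    push_cast
    linarith

theorem exists_le_of_integrable_norm {E : Type*} [NormedAddCommGroup E] [MeasurableSpace E]
    {μ : Measure E} (hμ : μ Set.univ = ⊤) {g : ℝ → ℝ}
    (hint : Integrable (fun x : E => g ‖x‖) μ) {c : ℝ} (hc : 0 < c) :
    ∃ r, 0 ≤ r ∧ g r ≤ c := by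
  by_contra! h
  have : Integrable (fun _ : E => c) μ := by
    refine hint.mono' aestronglyMeasurable_const (Eventually.of_forall fun x => ?_)
    rw [Real.norm_of_nonneg hc.le]
    exact (h ‖x‖ (norm_nonneg x)).le
  rw [integrable_const_iff] at this
  rcases this with h' | h'
  · exact hc.ne' h'
  · exact (measure_lt_top μ Set.univ).ne hμ

theorem exists_autocorrelation_le_half {E : Type*} [NormedAddCommGroup E]
    [MeasurableSpace E] [BorelSpace E] {μ : Measure E} [μ.IsAddRightInvariant]
    (hμ : μ Set.univ = ⊤) {g : ℝ → ℝ} (hmono : AntitoneOn g (Set.Ici (0 : ℝ)))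
    (hrange : ∀ x ∈ Set.Ici (0 : ℝ), g x ∈ Set.Icc (0 : ℝ) 1)
    (hint : Integrable (fun x : E => g ‖x‖) μ) :
    ∃ K > 0, ∀ y : E, K ≤ ‖y‖ →
      ∫ x, g ‖x‖ * g ‖x - y‖ ∂μ ≤ (∫ x, g ‖x‖ ∂μ) / 2 := by
  obtain ⟨r, hr, hgr⟩ := exists_le_of_integrable_norm hμ hint (c := 1 / 4) (by norm_num)
  refine ⟨2 * r + 1, by positivity, fun y hy => ?_⟩
  have h0 : ∀ x : E, 0 ≤ g ‖x‖ := fun x => (hrange _ (norm_nonneg x)).1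
  have hsub : Integrable (fun x => g ‖x - y‖) μ := hint.comp_sub_right y
  have hsum : ∫ x, (1 / 4) * (g ‖x‖ + g ‖x - y‖) ∂μ = (∫ x, g ‖x‖ ∂μ) / 2 := by
    rw [integral_const_mul, integral_add hint hsub,
      integral_sub_right_eq_self (fun x => g ‖x‖) y]
    ring
  rw [← hsum]
  refine integral_mono_of_nonneg (Eventually.of_forall fun x => mul_nonneg (h0 _) (h0 _))
    ((hint.add hsub).const_mul _) (Eventually.of_forall fun x => ?_)
  have hle : ∀ w : E, r ≤ ‖w‖ → g ‖w‖ ≤ 1 / 4 := fun w hw =>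
    (hmono hr (norm_nonneg w) hw).trans hgr
  simp only
  have a := h0 x
  have b := h0 (x - y)
  by_cases hx : r ≤ ‖x‖
  · nlinarith [hle x hx]
  · have : r ≤ ‖x - y‖ := by
      have := norm_sub_norm_le y x
      rw [norm_sub_rev] at this
      linarith
    nlinarith [hle _ this]

/-- Linear decay of the autocorrelation away from the origin, capped at unit scale. -/
theorem exists_autocorrelation_le {E : Type*} [NormedAddCommGroup E] [NormedSpace ℝ E]
    [MeasurableSpace E] [BorelSpace E] {μ : Measure E} [μ.IsAddRightInvariant]
    (hμ : μ Set.univ = ⊤) {g : ℝ → ℝ} (hmono : AntitoneOn g (Set.Ici (0 : ℝ)))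
    (hrange : ∀ x ∈ Set.Ici (0 : ℝ), g x ∈ Set.Icc (0 : ℝ) 1)
    (hint : Integrable (fun x : E => g ‖x‖) μ) :
    ∃ K > 0, ∀ y : E, ∫ x, g ‖x‖ * g ‖x - y‖ ∂μ
      ≤ (∫ x, g ‖x‖ ∂μ) * (1 - min (K * ‖y‖) (1 / 4)) := by
  obtain ⟨K, hK, hfar⟩ := exists_autocorrelation_le_half hμ hmono hrange hint
  refine ⟨(4 * K)⁻¹, by positivity, fun y => ?_⟩
  have h0 : ∀ x : E, 0 ≤ g ‖x‖ := fun x => (hrange _ (norm_nonneg x)).1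
  have h1 : ∀ x : E, g ‖x‖ ≤ 1 := fun x => (hrange _ (norm_nonneg x)).2
  have hC : 0 ≤ ∫ x, g ‖x‖ ∂μ := integral_nonneg h0
  set C := ∫ x, g ‖x‖ ∂μ with hCdef
  set t := ‖y‖ with ht
  rcases (norm_nonneg y).eq_or_lt with hy | hy
  · rw [← ht] at hy
    rw [← hy, mul_zero, min_eq_left (by norm_num), sub_zero, mul_one]
    refine integral_mono_of_nonneg (Eventually.of_forall fun x => mul_nonneg (h0 _) (h0 _)) hint
      (Eventually.of_forall fun x => ?_)
    exact mul_le_of_le_one_right (h0 _) (h1 _)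
  rw [← ht] at hy
  set n := ⌊K / t⌋₊ with hn
  have hn1 : (n : ℝ) ≤ K / t := Nat.floor_le (by positivity)
  have hn2 : K / t < n + 1 := Nat.lt_floor_add_one _
  have hsm : K ≤ ‖(n + 1) • y‖ := by
    rw [← Nat.cast_smul_eq_nsmul ℝ, norm_smul, Real.norm_natCast, ← ht]
    push_cast
    exact ((div_lt_iff₀ hy).1 hn2).le
  have key := autocorrelation_nsmul_le hint h0 h1 y n
  have far := hfar _ hsm
  set h := ∫ x, g ‖x‖ * g ‖x - y‖ ∂μ
  have hdef : C / 2 ≤ (n + 1) * (C - h) := by linarith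
  have hpos : 0 ≤ C - h := by
    by_contra! hneg
    nlinarith [(n.cast_nonneg : (0 : ℝ) ≤ n)]
  have hdef2 : C / 2 * t ≤ (K + t) * (C - h) := by
    have : ((n : ℝ) + 1) * t ≤ K + t := by
      have := (le_div_iff₀ hy).1 hn1
      linarith
    nlinarith
  rcases le_total t K with htK | htK
  · have : (4 * K)⁻¹ * t * C ≤ C - h := by
      rw [mul_assoc, inv_mul_le_iff₀ (by positivity)]
      nlinarith
    nlinarith [min_le_left ((4 * K)⁻¹ * t) (1 / 4)]
  · have : C / 4 ≤ C - h := by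
      by_contra! hlt
      nlinarith
    nlinarith [min_le_right ((4 * K)⁻¹ * t) (1 / 4)]

theorem integrable_exp_neg_norm {E : Type*} [NormedAddCommGroup E] [NormedSpace ℝ E]
    [FiniteDimensional ℝ E] [MeasurableSpace E] [BorelSpace E] (μ : Measure E)
    [μ.IsAddHaarMeasure] : Integrable (fun x : E => Real.exp (-‖x‖)) μ := by
  set d := Module.finrank ℝ E
  have hd : (Module.finrank ℝ E : ℝ) < ((d + 1 : ℕ) : ℝ) := by push_cast; exact lt_add_one _
  refine ((integrable_one_add_norm (μ := μ) hd).const_mul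
    (((d + 1).factorial : ℝ) * Real.exp 1)).mono' (by fun_prop) (Eventually.of_forall fun x => ?_)
  have hx : 0 < 1 + ‖x‖ := by positivity
  have := Real.pow_div_factorial_le_exp (1 + ‖x‖) hx.le (d + 1)
  rw [Real.exp_add, div_le_iff₀ (by positivity)] at this
  rw [Real.norm_of_nonneg (Real.exp_pos _).le, Real.rpow_neg hx.le, Real.rpow_natCast,
    Real.exp_neg, ← div_eq_mul_inv, le_div_iff₀ (by positivity), inv_mul_le_iff₀ (Real.exp_pos _)]
  linarith

/-- An upper bound, on a disk of radius `R`, for the integral of `exp (l * ψ)` when `ψ` has a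
linear decay at the origin. -/
theorem setIntegral_exp_le {E : Type*} [NormedAddCommGroup E] [NormedSpace ℝ E]
    [FiniteDimensional ℝ E] [MeasurableSpace E] [BorelSpace E] {μ : Measure E}
    [μ.IsAddHaarMeasure] {K l : ℝ} (hK : 0 < K) (hl : 0 < l) {ψ : E → ℝ} {δ : ℝ}
    (hψ : ∀ y, ψ y ≤ 1 - min (K * ‖y‖) δ) (R : ℝ) :
    ∫ y in Metric.closedBall (0 : E) R, Real.exp (l * ψ y) ∂μ
      ≤ Real.exp l * (((l * K) ^ Module.finrank ℝ E)⁻¹ * (∫ y, Real.exp (-‖y‖) ∂μ)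
        + μ.real (Metric.closedBall (0 : E) R) * Real.exp (-(l * δ))) := by
  have hlK : 0 < l * K := by positivity
  have hexp : ∀ y : E, Real.exp (-(l * K * ‖y‖)) = Real.exp (-‖(l * K) • y‖) := fun y => by
    rw [norm_smul, Real.norm_of_nonneg hlK.le]
  have hi : Integrable (fun y : E => Real.exp (-(l * K * ‖y‖))) μ := by
    simp_rw [hexp]
    exact (integrable_exp_neg_norm μ).comp_smul hlK.ne'
  have hc : IntegrableOn (fun _ : E => Real.exp (-(l * δ))) (Metric.closedBall (0 : E) R) μ :=
    integrableOn_const Metric.isBounded_closedBall.measure_lt_top.ne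
  calc ∫ y in Metric.closedBall (0 : E) R, Real.exp (l * ψ y) ∂μ
      ≤ ∫ y in Metric.closedBall (0 : E) R, Real.exp l *
          (Real.exp (-(l * K * ‖y‖)) + Real.exp (-(l * δ))) ∂μ := by
        refine integral_mono_of_nonneg (Eventually.of_forall fun y => (Real.exp_pos _).le)
          ((hi.integrableOn.add hc).const_mul _) (Eventually.of_forall fun y => ?_)
        simp only
        rw [mul_add, ← Real.exp_add, ← Real.exp_add]
        have := mul_le_mul_of_nonneg_left (hψ y) hl.le
        rcases min_choice (K * ‖y‖) δ with h | h <;> rw [h] at this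
        · exact (Real.exp_le_exp.2 (by linarith)).trans
            (le_add_of_nonneg_right (Real.exp_pos _).le)
        · exact (Real.exp_le_exp.2 (by linarith)).trans
            (le_add_of_nonneg_left (Real.exp_pos _).le)
    _ = Real.exp l * ((∫ y in Metric.closedBall (0 : E) R, Real.exp (-(l * K * ‖y‖)) ∂μ)
          + μ.real (Metric.closedBall (0 : E) R) * Real.exp (-(l * δ))) := by
        rw [integral_const_mul, integral_add hi.integrableOn hc, setIntegral_const, smul_eq_mul]
    _ ≤ _ := by
        gcongr
        refine (setIntegral_le_integral hi
          (Eventually.of_forall fun y => (Real.exp_pos _).le)).trans_eq ?_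
        simp_rw [hexp]
        rw [Measure.integral_comp_smul_of_nonneg (hR := hlK.le) μ (fun y => Real.exp (-‖y‖)),
          smul_eq_mul]

theorem volume_real_closedBall_rpow_le {C L ρ ε : ℝ} (hC : 0 < C) (hCL : C ≤ L) (hρ : 0 < ρ)
    (hε : 0 < ε) :
    volume.real (Metric.closedBall (0 : EuclideanSpace ℝ (Fin 2))
      (2 * Real.sqrt (L / (C * ρ)) ^ (-ε))) ≤ 4 * π * Real.exp (ε * Real.log ρ) := by
  have hs : Real.exp (-(Real.log ρ / 2)) ≤ Real.sqrt (L / (C * ρ)) := by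
    apply Real.le_sqrt_of_sq_le
    rw [← Real.exp_nat_mul, Nat.cast_ofNat, mul_neg, mul_div_cancel₀ _ two_ne_zero, Real.exp_neg,
      Real.exp_log hρ, le_div_iff₀ (by positivity)]
    field_simp
    exact hCL
  have hr : Real.sqrt (L / (C * ρ)) ^ (-ε) ≤ Real.exp (ε * Real.log ρ / 2) := by
    refine (Real.rpow_le_rpow_of_nonpos (Real.exp_pos _) hs (by linarith)).trans_eq ?_
    rw [← Real.exp_mul]
    ring_nf
  have hr0 : 0 ≤ Real.sqrt (L / (C * ρ)) ^ (-ε) := by positivity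
  rw [Measure.real, EuclideanSpace.volume_closedBall_fin_two, ENNReal.toReal_mul,
    ENNReal.toReal_pow, ENNReal.toReal_ofReal (by positivity), ENNReal.toReal_ofReal pi_pos.le]
  have : (Real.sqrt (L / (C * ρ)) ^ (-ε)) ^ 2 ≤ Real.exp (ε * Real.log ρ) := by
    refine (pow_le_pow_left₀ hr0 hr 2).trans_eq ?_
    rw [← Real.exp_nat_mul]
    push_cast
    ring_nf
  nlinarith [mul_le_mul_of_nonneg_right this pi_pos.le]


open MeasureTheory Real Filter

/-- for non-increasing `g : [0,∞) → [0,1]` with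
`C := ∫_{ℝ²} g(‖x‖) dx ∈ (0,∞)` and `b ∈ ℝ`, there exists `ε₀ ∈ (0, 1/2)` such
that for every `ε ∈ (0, ε₀)`,
`lim_{ρ→∞} (λ_ρ/ρ) ∫_{D(0, 2 r_ρ^{−ε})} exp(λ_ρ ∫_{ℝ²} g(‖x‖) g(‖x − y‖) dx) dy = 0`,
where `λ_ρ := (log ρ + b)/C` and `r_ρ := √((log ρ + b)/(C ρ))`. -/
theorem b2_term_tendsto_zero
    (g : ℝ → ℝ)
    (hmono : AntitoneOn g (Set.Ici (0 : ℝ)))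
    (hrange : ∀ x ∈ Set.Ici (0 : ℝ), g x ∈ Set.Icc (0 : ℝ) 1)
    (hint : Integrable (fun x : EuclideanSpace ℝ (Fin 2) => g ‖x‖))
    (hpos : 0 < ∫ x : EuclideanSpace ℝ (Fin 2), g ‖x‖)
    (b : ℝ) :
    ∃ ε₀ : ℝ, 0 < ε₀ ∧ ε₀ < 1 / 2 ∧
      ∀ ε : ℝ, 0 < ε → ε < ε₀ →
        Tendsto (fun ρ : ℝ =>
          ((Real.log ρ + b) / (∫ x : EuclideanSpace ℝ (Fin 2), g ‖x‖) / ρ) *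
            ∫ y in Metric.closedBall (0 : EuclideanSpace ℝ (Fin 2))
                (2 * Real.sqrt ((Real.log ρ + b) /
                  ((∫ x : EuclideanSpace ℝ (Fin 2), g ‖x‖) * ρ)) ^ (-ε)),
              Real.exp (((Real.log ρ + b) / (∫ x : EuclideanSpace ℝ (Fin 2), g ‖x‖)) *
                ∫ x : EuclideanSpace ℝ (Fin 2), g ‖x‖ * g ‖x - y‖))
          atTop (nhds 0) := by
  set C := ∫ x : EuclideanSpace ℝ (Fin 2), g ‖x‖ with hCdef
  obtain ⟨K, hK, hauto⟩ := exists_autocorrelation_le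
    (measure_univ_of_isAddLeftInvariant (volume : Measure (EuclideanSpace ℝ (Fin 2))))
    hmono hrange hint
  rw [← hCdef] at hauto
  refine ⟨1 / 4, by norm_num, by norm_num, fun ε hε hε4 => ?_⟩
  set I := ∫ y : EuclideanSpace ℝ (Fin 2), Real.exp (-‖y‖)
  have hL : Tendsto (fun ρ : ℝ => Real.log ρ + b) atTop atTop :=
    tendsto_atTop_add_const_right _ b Real.tendsto_log_atTop
  have hbound : Tendsto (fun L : ℝ => Real.exp b / C * (I / K ^ 2 * L⁻¹ +
      4 * π * Real.exp (-(ε * b)) * (L ^ (1 : ℝ) * Real.exp (-(1 / 4 - ε) * L)))) atTop (nhds 0) := by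
    have h1 := (tendsto_inv_atTop_zero (𝕜 := ℝ)).const_mul (I / K ^ 2)
    have h2 := (tendsto_rpow_mul_exp_neg_mul_atTop_nhds_zero 1 (1 / 4 - ε) (by linarith)).const_mul
      (4 * π * Real.exp (-(ε * b)))
    simpa using (h1.add h2).const_mul (Real.exp b / C)
  refine tendsto_of_tendsto_of_tendsto_of_le_of_le' tendsto_const_nhds (hbound.comp hL) ?_ ?_
  · filter_upwards [eventually_gt_atTop 0, hL.eventually_ge_atTop 0] with ρ hρ hLρ
    have : 0 ≤ ∫ y in Metric.closedBall (0 : EuclideanSpace ℝ (Fin 2))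
        (2 * Real.sqrt ((Real.log ρ + b) / (C * ρ)) ^ (-ε)),
        Real.exp ((Real.log ρ + b) / C *
          ∫ x : EuclideanSpace ℝ (Fin 2), g ‖x‖ * g ‖x - y‖) :=
      integral_nonneg fun y => (Real.exp_pos _).le
    positivity
  · filter_upwards [eventually_gt_atTop 0, hL.eventually_ge_atTop C] with ρ hρ hLρ
    simp only [Function.comp]
    have hvol := volume_real_closedBall_rpow_le hpos hLρ hρ hε
    set L := Real.log ρ + b with hLdef
    have hlog : Real.log ρ = L - b := by rw [hLdef]; ring
    have hρL : ρ = Real.exp L / Real.exp b := by rw [← Real.exp_sub, ← hlog, Real.exp_log hρ]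
    have hL0 : 0 < L := hpos.trans_le hLρ
    have hψ : ∀ y : EuclideanSpace ℝ (Fin 2),
        (∫ x : EuclideanSpace ℝ (Fin 2), g ‖x‖ * g ‖x - y‖) / C
          ≤ 1 - min (K * ‖y‖) (1 / 4) := fun y => by
      rw [div_le_iff₀' hpos]
      exact hauto y
    have hmain := setIntegral_exp_le (μ := volume) hK hL0 hψ
      (2 * Real.sqrt (L / (C * ρ)) ^ (-ε))
    rw [finrank_euclideanSpace_fin] at hmain
    simp_rw [div_mul_eq_mul_div L C, ← mul_div_assoc] at hmain ⊢
    have hdecay : Real.exp (ε * Real.log ρ) * Real.exp (-(L * 1 / 4))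
        = Real.exp (-(ε * b)) * Real.exp (-(1 / 4 - ε) * L) := by
      rw [← Real.exp_add, ← Real.exp_add, hlog]
      ring_nf
    refine (mul_le_mul_of_nonneg_left hmain (by positivity)).trans ?_
    calc L / C / ρ * (Real.exp L * (((L * K) ^ 2)⁻¹ * I + _ * Real.exp (-(L * 1 / 4))))
        ≤ L / C / ρ * (Real.exp L * (((L * K) ^ 2)⁻¹ * I +
          4 * π * Real.exp (ε * Real.log ρ) * Real.exp (-(L * 1 / 4)))) := by gcongr
      _ = L / C / ρ * (Real.exp L * (((L * K) ^ 2)⁻¹ * I +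
          4 * π * (Real.exp (-(ε * b)) * Real.exp (-(1 / 4 - ε) * L)))) := by
        rw [mul_assoc (4 * π), hdecay]
      _ = _ := by
        rw [hρL, Real.rpow_one]
        field_simp
end

section
/- Let g : [0,∞) → [0,1] be non-increasing with 0 < C := ∫_{ℝ²} g(‖x‖) dx < ∞ and with g(x) = o(1/(x² log² x)) as x → ∞, let b ∈ ℝ, and let ε ∈ (0, 1/2) be a constant. Then lim_{ρ→∞} λ_ρ · ∫_{ℝ² \ D(0, r_ρ^{−ε})} g(‖x‖) dx = 0, where λ_ρ := (log ρ + b)/C and r_ρ := √((log ρ + b)/(C ρ)) (note λ_ρ = ρ r_ρ²). -/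
open MeasureTheory Real Filter Asymptotics

/-- The antiderivative `-1 / log x` of `1 / (x * log x ^ 2)` on `(1, ∞)`. -/
theorem hasDerivAt_neg_inv_log {x : ℝ} (hx : 1 < x) :
    HasDerivAt (fun y : ℝ => -(Real.log y)⁻¹) (1 / (x * Real.log x ^ 2)) x := by
  have hl : Real.log x ≠ 0 := (Real.log_pos hx).ne'
  have hx0 : x ≠ 0 := by positivity
  have h := ((Real.hasDerivAt_log hx0).inv hl).neg
  have he : 1 / (x * Real.log x ^ 2) = -(-x⁻¹ / Real.log x ^ 2) := by
    field_simp
  rw [he]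
  exact h

theorem tendsto_neg_inv_log_atTop :
    Tendsto (fun y : ℝ => -(Real.log y)⁻¹) atTop (nhds 0) := by
  simpa using (tendsto_inv_atTop_zero.comp Real.tendsto_log_atTop).neg

theorem integrableOn_Ioi_one_div_mul_log_sq {R : ℝ} (hR : 1 < R) :
    IntegrableOn (fun x : ℝ => 1 / (x * Real.log x ^ 2)) (Set.Ioi R) := by
  refine integrableOn_Ioi_deriv_of_nonneg' (fun x hx => hasDerivAt_neg_inv_log (hR.trans_le hx))
    (fun x hx => ?_) tendsto_neg_inv_log_atTop
  have : 0 < x := by linarith [Set.mem_Ioi.mp hx]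
  positivity

theorem integral_Ioi_one_div_mul_log_sq {R : ℝ} (hR : 1 < R) :
    ∫ x in Set.Ioi R, 1 / (x * Real.log x ^ 2) = (Real.log R)⁻¹ := by
  rw [integral_Ioi_of_hasDerivAt_of_tendsto'
    (fun x hx => hasDerivAt_neg_inv_log (hR.trans_le hx))
    (integrableOn_Ioi_one_div_mul_log_sq hR) tendsto_neg_inv_log_atTop]
  ring

/-- Polar coordinates for a radial function in the plane outside a disk. -/
theorem setIntegral_compl_closedBall_fun_norm (g : ℝ → ℝ) {R : ℝ} (hR : 0 ≤ R) :
    ∫ x in (Metric.closedBall (0 : EuclideanSpace ℝ (Fin 2)) R)ᶜ, g ‖x‖ =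
      2 * volume.real (Metric.ball (0 : EuclideanSpace ℝ (Fin 2)) 1) *
        ∫ y in Set.Ioi R, y * g y := by
  have h := integral_fun_norm_addHaar (volume : Measure (EuclideanSpace ℝ (Fin 2)))
    ((Set.Ioi R).indicator g)
  have hl : (fun x : EuclideanSpace ℝ (Fin 2) => (Set.Ioi R).indicator g ‖x‖) =
      (Metric.closedBall (0 : EuclideanSpace ℝ (Fin 2)) R)ᶜ.indicator (fun x => g ‖x‖) := by
    ext x
    by_cases hx : R < ‖x‖
    · rw [Set.indicator_of_mem (by simpa using hx), Set.indicator_of_mem (by simpa using hx)]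
    · rw [Set.indicator_of_notMem (by simpa using hx), Set.indicator_of_notMem (by simpa using hx)]
  have hr : (fun y : ℝ => y ^ (2 - 1) • (Set.Ioi R).indicator g y) =
      (Set.Ioi R).indicator (fun y => y * g y) := by
    ext y
    simp [Set.indicator_apply]
  rw [hl, integral_indicator Metric.isClosed_closedBall.measurableSet.compl,
    finrank_euclideanSpace_fin, hr, setIntegral_indicator measurableSet_Ioi,
    Set.inter_eq_self_of_subset_right (Set.Ioi_subset_Ioi hR)] at h
  rw [h]
  simp [mul_assoc]

/-- If `g = o(1 / (x² log² x))` then the tail integral of `y * g y` is `o(1 / log R)`. -/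
theorem tendsto_log_mul_integral_Ioi (g : ℝ → ℝ)
    (hg : g =o[atTop] fun x : ℝ => 1 / (x ^ 2 * Real.log x ^ 2)) :
    Tendsto (fun R : ℝ => Real.log R * ∫ y in Set.Ioi R, y * g y) atTop (nhds 0) := by
  rw [Metric.tendsto_nhds]
  intro δ hδ
  obtain ⟨A, hA⟩ := eventually_atTop.mp (hg.def (half_pos hδ))
  filter_upwards [eventually_ge_atTop A, eventually_gt_atTop 1] with R hRA hR
  have hlog := Real.log_pos hR
  have hbound : ‖∫ y in Set.Ioi R, y * g y‖ ≤
      ∫ y in Set.Ioi R, δ / 2 * (1 / (y * Real.log y ^ 2)) := by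
    refine norm_integral_le_of_norm_le ((integrableOn_Ioi_one_div_mul_log_sq hR).const_mul _) ?_
    filter_upwards [ae_restrict_mem measurableSet_Ioi] with y hy
    have hy1 : 1 < y := hR.trans hy
    have hy0 : 0 < y := by linarith
    have hly := Real.log_pos hy1
    have h := hA y (hRA.trans (le_of_lt hy))
    rw [norm_mul, Real.norm_of_nonneg hy0.le]
    rw [Real.norm_of_nonneg (by positivity : 0 ≤ 1 / (y ^ 2 * Real.log y ^ 2))] at h
    calc y * ‖g y‖ ≤ y * (δ / 2 * (1 / (y ^ 2 * Real.log y ^ 2))) := by gcongr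
      _ = δ / 2 * (1 / (y * Real.log y ^ 2)) := by field_simp
  rw [integral_const_mul, integral_Ioi_one_div_mul_log_sq hR] at hbound
  rw [dist_zero_right, norm_mul, Real.norm_of_nonneg hlog.le]
  calc Real.log R * ‖∫ y in Set.Ioi R, y * g y‖
      ≤ Real.log R * (δ / 2 * (Real.log R)⁻¹) := by gcongr
    _ = δ / 2 := by field_simp
    _ < δ := half_lt_self hδ

/-- The logarithm of the truncation radius `r_ρ ^ (-ε)` is asymptotic to `(ε / 2) (log ρ + b)`. -/
theorem tendsto_log_radius_div {C : ℝ} (hC : 0 < C) (b ε : ℝ) :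
    Tendsto (fun ρ : ℝ =>
      Real.log (Real.sqrt ((Real.log ρ + b) / (C * ρ)) ^ (-ε)) / (Real.log ρ + b))
      atTop (nhds (ε / 2)) := by
  have hu : Tendsto (fun ρ : ℝ => Real.log ρ + b) atTop atTop :=
    tendsto_atTop_add_const_right _ _ Real.tendsto_log_atTop
  have hlim : Tendsto (fun u : ℝ => ε / 2 * (1 + (Real.log C - b) / u - Real.log u / u))
      atTop (nhds (ε / 2)) := by
    have h1 : Tendsto (fun u : ℝ => (Real.log C - b) / u) atTop (nhds 0) :=
      tendsto_const_nhds.div_atTop tendsto_id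
    have h2 : Tendsto (fun u : ℝ => Real.log u / u) atTop (nhds 0) :=
      Real.isLittleO_log_id_atTop.tendsto_div_nhds_zero
    simpa using ((h1.const_add 1).sub h2).const_mul (ε / 2)
  refine (hlim.comp hu).congr' ?_
  filter_upwards [hu.eventually_gt_atTop 0, eventually_gt_atTop 0] with ρ hρu hρ
  have hq : 0 < (Real.log ρ + b) / (C * ρ) := by positivity
  rw [Real.log_rpow (Real.sqrt_pos.mpr hq), Real.log_sqrt hq.le,
    Real.log_div hρu.ne' (by positivity), Real.log_mul hC.ne' hρ.ne', Function.comp_apply]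
  field_simp
  ring

/-- for non-increasing `g : [0,∞) → [0,1]` with
`C := ∫_{ℝ²} g(‖x‖) dx ∈ (0,∞)` and `g(x) = o(1/(x² log² x))`, any `b ∈ ℝ` and
constant `ε ∈ (0, 1/2)`,
`lim_{ρ→∞} λ_ρ ∫_{ℝ² \ D(0, r_ρ^{−ε})} g(‖x‖) dx = 0`,
where `λ_ρ := (log ρ + b)/C` and `r_ρ := √((log ρ + b)/(C ρ))`. -/
theorem truncation_tail_tendsto_zero
    (g : ℝ → ℝ)
    (hmono : AntitoneOn g (Set.Ici (0 : ℝ)))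
    (hrange : ∀ x ∈ Set.Ici (0 : ℝ), g x ∈ Set.Icc (0 : ℝ) 1)
    (hint : Integrable (fun x : EuclideanSpace ℝ (Fin 2) => g ‖x‖))
    (hpos : 0 < ∫ x : EuclideanSpace ℝ (Fin 2), g ‖x‖)
    (hlittleo : g =o[atTop] fun x : ℝ => 1 / (x ^ 2 * Real.log x ^ 2))
    (b : ℝ) (ε : ℝ) (hε : 0 < ε) (hε' : ε < 1 / 2) :
    Tendsto (fun ρ : ℝ =>
      ((Real.log ρ + b) / (∫ x : EuclideanSpace ℝ (Fin 2), g ‖x‖)) *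
        ∫ x in (Metric.closedBall (0 : EuclideanSpace ℝ (Fin 2))
            (Real.sqrt ((Real.log ρ + b) /
              ((∫ x : EuclideanSpace ℝ (Fin 2), g ‖x‖) * ρ)) ^ (-ε)))ᶜ,
          g ‖x‖)
      atTop (nhds 0) := by
  set C := ∫ x : EuclideanSpace ℝ (Fin 2), g ‖x‖ with hC
  have hu : Tendsto (fun ρ : ℝ => Real.log ρ + b) atTop atTop :=
    tendsto_atTop_add_const_right _ _ Real.tendsto_log_atTop
  have hratio := tendsto_log_radius_div hpos b ε
  set R : ℝ → ℝ := fun ρ => Real.sqrt ((Real.log ρ + b) / (C * ρ)) ^ (-ε) with hR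
  have hRpos : ∀ᶠ ρ in atTop, 0 < R ρ := by
    filter_upwards [hu.eventually_gt_atTop 0, eventually_gt_atTop 0] with ρ hρu hρ
    simp only [hR]
    positivity
  have hlogR : Tendsto (fun ρ => Real.log (R ρ)) atTop atTop := by
    refine (hratio.pos_mul_atTop (half_pos hε) hu).congr' ?_
    filter_upwards [hu.eventually_gt_atTop 0] with ρ hρu
    exact div_mul_cancel₀ _ hρu.ne'
  have hRtop : Tendsto R atTop atTop := by
    refine (Real.tendsto_exp_atTop.comp hlogR).congr' ?_
    filter_upwards [hRpos] with ρ hρ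
    exact Real.exp_log hρ
  have htail := (tendsto_log_mul_integral_Ioi g hlittleo).comp hRtop
  set K := 2 * volume.real (Metric.ball (0 : EuclideanSpace ℝ (Fin 2)) 1) with hK
  have hlim := ((hratio.inv₀ (half_pos hε).ne').mul htail).const_mul (K / C)
  rw [mul_zero, mul_zero] at hlim
  refine hlim.congr' ?_
  filter_upwards [hu.eventually_gt_atTop 0, hRpos, hlogR.eventually_gt_atTop 0]
    with ρ hρu hρ hlog
  change _ = (Real.log ρ + b) / C *
    ∫ x in (Metric.closedBall (0 : EuclideanSpace ℝ (Fin 2)) (R ρ))ᶜ, g ‖x‖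
  rw [setIntegral_compl_closedBall_fun_norm g hρ.le, ← hK, Function.comp_apply]
  change K / C * ((Real.log (R ρ) / (Real.log ρ + b))⁻¹ * _) = _
  field_simp
end

section
/- Let g : [0,∞) → [0,1] be non-increasing with 0 < C := ∫_{ℝ²} g(‖x‖) dx < ∞ and with g(x) = o(1/(x² log² x)) as x → ∞, let b ∈ ℝ, and let ε ∈ (0, 1/2) be a constant. Then lim_{ρ→∞} ρ · exp(− ρ · ∫_{D(0, r_ρ^{1−ε})} g(‖x‖ / r_ρ) dx) = e^{−b}, where r_ρ := √((log ρ + b)/(C ρ)). -/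
open MeasureTheory Real Filter Asymptotics

/-- The integral of `1 / (x * log x ^ 2)` over `(R, ∞)` is `1 / log R`. -/
lemma integrableOn_and_integral_Ioi_inv_mul_log_sq {R : ℝ} (hR : 1 < R) :
    IntegrableOn (fun x : ℝ => 1 / (x * Real.log x ^ 2)) (Set.Ioi R) ∧
      ∫ x in Set.Ioi R, 1 / (x * Real.log x ^ 2) = (Real.log R)⁻¹ := by
  have hderiv : ∀ x ∈ Set.Ici R,
      HasDerivAt (fun x => -(Real.log x)⁻¹) (1 / (x * Real.log x ^ 2)) x := by
    intro x hx
    have hx1 : 1 < x := lt_of_lt_of_le hR hx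
    have hl : Real.log x ≠ 0 := (Real.log_pos hx1).ne'
    have hx0 : x ≠ 0 := by positivity
    refine ((Real.hasDerivAt_log hx0).inv hl).neg.congr_deriv ?_
    field_simp
  have hnonneg : ∀ x ∈ Set.Ioi R, 0 ≤ 1 / (x * Real.log x ^ 2) := by
    intro x hx
    have hx0 : 0 < x := zero_lt_one.trans (hR.trans hx)
    positivity
  have hlim : Tendsto (fun x => -(Real.log x)⁻¹) atTop (nhds 0) := by
    simpa using (tendsto_inv_atTop_zero.comp Real.tendsto_log_atTop).neg
  refine ⟨integrableOn_Ioi_deriv_of_nonneg' hderiv hnonneg hlim, ?_⟩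
  rw [integral_Ioi_of_hasDerivAt_of_nonneg' hderiv hnonneg hlim]
  simp

/-- In the plane, the tail integral of a radial function that is `o(1 / (x² log² x))` is
`o(1 / log R)`. -/
lemma tendsto_log_mul_integral_compl_closedBall {g : ℝ → ℝ}
    (hg : ∀ x ∈ Set.Ici (0 : ℝ), 0 ≤ g x)
    (hlittleo : g =o[atTop] fun x : ℝ => 1 / (x ^ 2 * Real.log x ^ 2)) :
    Tendsto (fun R : ℝ => Real.log R *
      ∫ x in (Metric.closedBall (0 : EuclideanSpace ℝ (Fin 2)) R)ᶜ, g ‖x‖) atTop (nhds 0) := by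
  set K : ℝ := 2 * volume.real (Metric.ball (0 : EuclideanSpace ℝ (Fin 2)) 1) with hK
  have hK0 : 0 ≤ K := by positivity
  have hpolar : ∀ R : ℝ, 0 < R →
      ∫ x in (Metric.closedBall (0 : EuclideanSpace ℝ (Fin 2)) R)ᶜ, g ‖x‖ =
        K * ∫ y in Set.Ioi R, y * g y := by
    intro R hR
    have h := integral_fun_norm_addHaar (volume : Measure (EuclideanSpace ℝ (Fin 2)))
      ((Set.Ioi R).indicator g)
    rw [← integral_indicator Metric.isClosed_closedBall.measurableSet.compl]
    have h1 : (Metric.closedBall (0 : EuclideanSpace ℝ (Fin 2)) R)ᶜ.indicator (fun x => g ‖x‖) =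
        fun x => (Set.Ioi R).indicator g ‖x‖ := by
      ext x
      by_cases hx : R < ‖x‖ <;> simp [Set.indicator, hx]
    have h2 : ∫ y in Set.Ioi (0 : ℝ), y ^ (2 - 1) • (Set.Ioi R).indicator g y =
        ∫ y in Set.Ioi R, y * g y := by
      have h3 : (fun y : ℝ => y ^ (2 - 1) • (Set.Ioi R).indicator g y) =
          (Set.Ioi R).indicator (fun y => y * g y) := by
        ext y
        by_cases hy : R < y <;> simp [hy]
      rw [h3, setIntegral_indicator measurableSet_Ioi, Set.Ioi_inter_Ioi, max_eq_right hR.le]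
    rw [h1, h, finrank_euclideanSpace_fin, h2, hK]
    simp [mul_assoc]
  have hbound : ∀ δ : ℝ, 0 < δ → ∀ᶠ R in atTop,
      ‖Real.log R * ∫ x in (Metric.closedBall (0 : EuclideanSpace ℝ (Fin 2)) R)ᶜ, g ‖x‖‖
        ≤ K * δ := by
    intro δ hδ
    obtain ⟨A, hA⟩ := eventually_atTop.1 (hlittleo.bound hδ)
    filter_upwards [eventually_gt_atTop 1, eventually_ge_atTop A] with R hR1 hRA
    have hR0 : 0 < R := zero_lt_one.trans hR1
    obtain ⟨hI, hval⟩ := integrableOn_and_integral_Ioi_inv_mul_log_sq hR1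
    have hnn : 0 ≤ᵐ[volume.restrict (Set.Ioi R)] fun y => y * g y := by
      filter_upwards [ae_restrict_mem measurableSet_Ioi] with y hy
      have hy0 : 0 ≤ y := (hR0.trans hy).le
      exact mul_nonneg hy0 (hg y hy0)
    have hle : ∫ y in Set.Ioi R, y * g y ≤ δ * (Real.log R)⁻¹ := by
      rw [← hval, ← integral_const_mul]
      refine integral_mono_of_nonneg hnn (hI.const_mul δ) ?_
      filter_upwards [ae_restrict_mem measurableSet_Ioi] with y hy
      have hy0 : 0 < y := hR0.trans hy
      have hb := hA y (hRA.trans (le_of_lt hy))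
      rw [Real.norm_of_nonneg (hg y hy0.le), Real.norm_of_nonneg (by positivity)] at hb
      have hlog : 0 < Real.log y := Real.log_pos (hR1.trans hy)
      calc y * g y ≤ y * (δ * (1 / (y ^ 2 * Real.log y ^ 2))) := by gcongr
        _ = δ * (1 / (y * Real.log y ^ 2)) := by field_simp
    have hlogR : 0 < Real.log R := Real.log_pos hR1
    have hint0 : 0 ≤ ∫ y in Set.Ioi R, y * g y := integral_nonneg_of_ae hnn
    rw [hpolar R hR0, Real.norm_of_nonneg (by positivity)]
    calc Real.log R * (K * ∫ y in Set.Ioi R, y * g y)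
        ≤ Real.log R * (K * (δ * (Real.log R)⁻¹)) := by gcongr
      _ = K * δ := by field_simp
  rw [Metric.tendsto_nhds]
  intro η hη
  filter_upwards [hbound (η / (K + 1)) (by positivity)] with R hR
  rw [dist_zero_right]
  refine hR.trans_lt ?_
  rw [mul_div_assoc', div_lt_iff₀ (by positivity)]
  nlinarith

/-- Rescaling a radial integral over a disk in the plane. -/
lemma setIntegral_closedBall_norm_div (g : ℝ → ℝ) {r s : ℝ} (hr : 0 < r) (hs : 0 ≤ s) :
    ∫ x in Metric.closedBall (0 : EuclideanSpace ℝ (Fin 2)) s, g (‖x‖ / r) =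
      r ^ 2 * ∫ x in Metric.closedBall (0 : EuclideanSpace ℝ (Fin 2)) (s / r), g ‖x‖ := by
  have h := Measure.setIntegral_comp_smul_of_pos
    (volume : Measure (EuclideanSpace ℝ (Fin 2))) (fun x => g ‖x‖)
    (Metric.closedBall (0 : EuclideanSpace ℝ (Fin 2)) s) (inv_pos.2 hr)
  rw [smul_closedBall _ _ hs, smul_zero, norm_inv, Real.norm_of_nonneg hr.le,
    inv_mul_eq_div, finrank_euclideanSpace_fin] at h
  simpa [norm_smul, abs_of_pos hr, inv_mul_eq_div] using h

/-- If `r = √(L / (C ρ))` with `L = log ρ + b`, then `L` is of the order of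
`log (r ^ (-ε)) → ∞`. -/
lemma tendsto_log_rpow_neg_sqrt {C ε : ℝ} (b : ℝ) (hC : 0 < C) (hε : 0 < ε) :
    Tendsto (fun ρ : ℝ => Real.sqrt ((Real.log ρ + b) / (C * ρ)) ^ (-ε)) atTop atTop ∧
    Tendsto (fun ρ : ℝ => (Real.log ρ + b) /
      Real.log (Real.sqrt ((Real.log ρ + b) / (C * ρ)) ^ (-ε))) atTop (nhds (2 / ε)) := by
  have hL : Tendsto (fun ρ : ℝ => Real.log ρ + b) atTop atTop :=
    tendsto_atTop_add_const_right _ _ Real.tendsto_log_atTop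
  have hratio : Tendsto (fun L : ℝ => ε / 2 * (1 + (Real.log C - b) / L - Real.log L / L))
      atTop (nhds (ε / 2)) := by
    have h1 : Tendsto (fun L : ℝ => (Real.log C - b) / L) atTop (nhds 0) :=
      tendsto_const_nhds.div_atTop tendsto_id
    have h2 : Tendsto (fun L : ℝ => Real.log L / L) atTop (nhds 0) :=
      Real.isLittleO_log_id_atTop.tendsto_div_nhds_zero
    simpa using (((tendsto_const_nhds (x := (1 : ℝ))).add h1).sub h2).const_mul (ε / 2)
  have hlog : ∀ᶠ ρ : ℝ in atTop, 0 < ρ ∧ 0 < Real.log ρ + b ∧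
      Real.log (Real.sqrt ((Real.log ρ + b) / (C * ρ)) ^ (-ε)) =
        (Real.log ρ + b) * (ε / 2 * (1 + (Real.log C - b) / (Real.log ρ + b) -
          Real.log (Real.log ρ + b) / (Real.log ρ + b))) := by
    filter_upwards [eventually_gt_atTop 0, hL.eventually_gt_atTop 0] with ρ hρ hLρ
    refine ⟨hρ, hLρ, ?_⟩
    rw [Real.log_rpow (by positivity), Real.log_sqrt (by positivity),
      Real.log_div hLρ.ne' (by positivity), Real.log_mul hC.ne' hρ.ne']
    field_simp
    ring
  have hlogTop : Tendsto (fun ρ : ℝ =>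
      Real.log (Real.sqrt ((Real.log ρ + b) / (C * ρ)) ^ (-ε))) atTop atTop := by
    refine (hL.atTop_mul_pos (half_pos hε) (hratio.comp hL)).congr' ?_
    filter_upwards [hlog] with ρ h
    exact h.2.2.symm
  constructor
  · refine (Real.tendsto_exp_atTop.comp hlogTop).congr' ?_
    filter_upwards [hlog] with ρ ⟨hρ, hLρ, _⟩
    exact Real.exp_log (by positivity)
  · have h := (hratio.comp hL).inv₀ (half_pos hε).ne'
    rw [inv_div] at h
    refine h.congr' ?_
    filter_upwards [hlog] with ρ ⟨_, hLρ, h⟩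
    rw [h, Function.comp_apply, div_mul_eq_div_div, div_self hLρ.ne', one_div]

open MeasureTheory Real Filter Asymptotics

/-- for non-increasing `g : [0,∞) → [0,1]` with
`C := ∫_{ℝ²} g(‖x‖) dx ∈ (0,∞)` and `g(x) = o(1/(x² log² x))`, any `b ∈ ℝ` and
constant `ε ∈ (0, 1/2)`,
`lim_{ρ→∞} ρ · exp(− ρ ∫_{D(0, r_ρ^{1−ε})} g(‖x‖/r_ρ) dx) = e^{−b}`,
where `r_ρ := √((log ρ + b)/(C ρ))`. -/
theorem truncated_isolation_probability_limit
    (g : ℝ → ℝ)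
    (hmono : AntitoneOn g (Set.Ici (0 : ℝ)))
    (hrange : ∀ x ∈ Set.Ici (0 : ℝ), g x ∈ Set.Icc (0 : ℝ) 1)
    (hint : Integrable (fun x : EuclideanSpace ℝ (Fin 2) => g ‖x‖))
    (hpos : 0 < ∫ x : EuclideanSpace ℝ (Fin 2), g ‖x‖)
    (hlittleo : g =o[atTop] fun x : ℝ => 1 / (x ^ 2 * Real.log x ^ 2))
    (b : ℝ) (ε : ℝ) (hε : 0 < ε) (hε' : ε < 1 / 2) :
    Tendsto (fun ρ : ℝ =>
      ρ * Real.exp (-(ρ *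
        ∫ x in Metric.closedBall (0 : EuclideanSpace ℝ (Fin 2))
            (Real.sqrt ((Real.log ρ + b) /
              ((∫ x : EuclideanSpace ℝ (Fin 2), g ‖x‖) * ρ)) ^ ((1 : ℝ) - ε)),
          g (‖x‖ / Real.sqrt ((Real.log ρ + b) /
              ((∫ x : EuclideanSpace ℝ (Fin 2), g ‖x‖) * ρ))))))
      atTop (nhds (Real.exp (-b))) := by
  set C : ℝ := ∫ x : EuclideanSpace ℝ (Fin 2), g ‖x‖ with hC
  set T : ℝ → ℝ := fun R =>
    ∫ x in (Metric.closedBall (0 : EuclideanSpace ℝ (Fin 2)) R)ᶜ, g ‖x‖ with hT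
  set r : ℝ → ℝ := fun ρ => Real.sqrt ((Real.log ρ + b) / (C * ρ)) with hr
  obtain ⟨hRTop, hratio⟩ := tendsto_log_rpow_neg_sqrt b hpos hε
  have htail := (tendsto_log_mul_integral_compl_closedBall
    (fun x hx => (hrange x hx).1) hlittleo).comp hRTop
  have herr : Tendsto (fun ρ => (Real.log ρ + b) / C * T (r ρ ^ (-ε))) atTop (nhds 0) := by
    have h := (hratio.mul htail).div_const C
    rw [mul_zero, zero_div] at h
    refine h.congr' ?_
    filter_upwards [hRTop.eventually_gt_atTop 1] with ρ hρ
    have hlog : Real.log (r ρ ^ (-ε)) ≠ 0 := (Real.log_pos hρ).ne'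
    simp only [Function.comp_apply]
    change (Real.log ρ + b) / Real.log (r ρ ^ (-ε)) *
      (Real.log (r ρ ^ (-ε)) * T (r ρ ^ (-ε))) / C = _
    field_simp
  have hexp : Tendsto (fun ρ => Real.exp (-b) *
      Real.exp ((Real.log ρ + b) / C * T (r ρ ^ (-ε)))) atTop (nhds (Real.exp (-b))) := by
    simpa using ((Real.continuous_exp.tendsto 0).comp herr).const_mul (Real.exp (-b))
  refine hexp.congr' ?_
  have hL : Tendsto (fun ρ : ℝ => Real.log ρ + b) atTop atTop :=
    tendsto_atTop_add_const_right _ _ Real.tendsto_log_atTop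
  filter_upwards [eventually_gt_atTop 0, hL.eventually_gt_atTop 0] with ρ hρ hLρ
  have hr0 : 0 < r ρ := Real.sqrt_pos.2 (by positivity)
  have hrsq : r ρ ^ 2 = (Real.log ρ + b) / (C * ρ) := Real.sq_sqrt (by positivity)
  have hdiv : r ρ ^ (1 - ε) / r ρ = r ρ ^ (-ε) := by
    rw [sub_eq_add_neg, Real.rpow_add hr0, Real.rpow_one, mul_div_cancel_left₀ _ hr0.ne']
  have hsplit : ∫ x in Metric.closedBall (0 : EuclideanSpace ℝ (Fin 2)) (r ρ ^ (-ε)), g ‖x‖ =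
      C - T (r ρ ^ (-ε)) :=
    eq_sub_of_add_eq (integral_add_compl Metric.isClosed_closedBall.measurableSet hint)
  change _ = ρ * Real.exp (-(ρ * ∫ x in Metric.closedBall (0 : EuclideanSpace ℝ (Fin 2))
    (r ρ ^ (1 - ε)), g (‖x‖ / r ρ)))
  rw [setIntegral_closedBall_norm_div g hr0 (by positivity), hdiv, hsplit, hrsq]
  have hexponent : -(ρ * ((Real.log ρ + b) / (C * ρ) * (C - T (r ρ ^ (-ε))))) =
      -Real.log ρ + (-b + (Real.log ρ + b) / C * T (r ρ ^ (-ε))) := by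
    field_simp
    ring
  rw [hexponent, Real.exp_add (-Real.log ρ), Real.exp_neg (Real.log ρ), Real.exp_log hρ,
    mul_inv_cancel_left₀ hρ.ne', Real.exp_add]
end

section
/- Let g : [0,∞) → [0,1] be a Borel-measurable function, let B ⊂ ℝ² be a measurable set of finite Lebesgue measure, let λ > 0, and let k ≥ 1 be an integer. Then ∫_{B^k} exp(− λ ∫_B (1 − ∏_{i=1}^{k} (1 − g(‖y − x_i‖))) dy) d(x₁, …, x_k) ≥ (∫_B exp(− λ ∫_B g(‖x − y‖) dy) dx)^k. -/
open MeasureTheory Real Filter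

theorem one_sub_prod_one_sub_le_sum {ι : Type*} (s : Finset ι) (p : ι → ℝ)
    (hp : ∀ i, p i ∈ Set.Icc (0 : ℝ) 1) :
    1 - ∏ i ∈ s, (1 - p i) ≤ ∑ i ∈ s, p i := by
  classical
  induction s using Finset.induction_on with
  | empty => simp
  | insert a s ha ih =>
    rw [Finset.prod_insert ha, Finset.sum_insert ha]
    have hle : ∏ i ∈ s, (1 - p i) ≤ 1 :=
      Finset.prod_le_one (fun i _ => sub_nonneg.2 (hp i).2)
        fun i _ => sub_le_self 1 (hp i).1
    nlinarith [mul_le_mul_of_nonneg_left hle (hp a).1]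

theorem one_sub_prod_one_sub_mem_Icc {ι : Type*} (s : Finset ι) (p : ι → ℝ)
    (hp : ∀ i, p i ∈ Set.Icc (0 : ℝ) 1) :
    1 - ∏ i ∈ s, (1 - p i) ∈ Set.Icc (0 : ℝ) 1 := by
  have hle : ∏ i ∈ s, (1 - p i) ≤ 1 :=
    Finset.prod_le_one (fun i _ => sub_nonneg.2 (hp i).2)
      fun i _ => sub_le_self 1 (hp i).1
  exact ⟨sub_nonneg.2 hle,
    sub_le_self 1 (Finset.prod_nonneg fun i _ => sub_nonneg.2 (hp i).2)⟩

theorem integrable_of_measurable_of_mem_Icc {α : Type*} [MeasurableSpace α] {μ : Measure α}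
    [IsFiniteMeasure μ] {f : α → ℝ} (hf : Measurable f) (h : ∀ x, f x ∈ Set.Icc (0 : ℝ) 1) :
    Integrable f μ :=
  Integrable.of_mem_Icc 0 1 hf.aemeasurable (Eventually.of_forall h)

theorem integrable_exp_neg_mul_integral {α β : Type*} [MeasurableSpace α] [MeasurableSpace β]
    {μ : Measure α} {ν : Measure β} [IsFiniteMeasure μ] [SFinite ν] {c : ℝ} (hc : 0 ≤ c)
    {f : α → β → ℝ} (hf : Measurable (Function.uncurry f)) (h : ∀ x y, 0 ≤ f x y) :
    Integrable (fun x => Real.exp (-(c * ∫ y, f x y ∂ν))) μ := by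
  have hm : Measurable fun x => ∫ y, f x y ∂ν :=
    (hf.stronglyMeasurable.integral_prod_right (ν := ν)).measurable
  refine integrable_of_measurable_of_mem_Icc (by fun_prop) fun x =>
    ⟨(Real.exp_pos _).le, Real.exp_le_one_iff.2 ?_⟩
  exact neg_nonpos.2 (mul_nonneg hc (integral_nonneg (h x)))

/-- for Borel-measurable `g : [0,∞) → [0,1]`, a measurable set
`B ⊂ ℝ²` of finite Lebesgue measure, `λ > 0` and an integer `k ≥ 1`,
`∫_{B^k} exp(−λ ∫_B (1 − ∏ᵢ (1 − g(‖y − xᵢ‖))) dy) d(x₁,…,x_k)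
  ≥ (∫_B exp(−λ ∫_B g(‖x − y‖) dy) dx)^k`. -/
theorem component_integral_ge_pow
    (g : ℝ → ℝ) (hmeas : Measurable g)
    (hrange : ∀ x ∈ Set.Ici (0 : ℝ), g x ∈ Set.Icc (0 : ℝ) 1)
    (B : Set (EuclideanSpace ℝ (Fin 2))) (hB : MeasurableSet B)
    (hBfin : volume B < ⊤)
    (lam : ℝ) (hlam : 0 < lam) (k : ℕ) (hk : 1 ≤ k) :
    (∫ x in B, Real.exp (-(lam * ∫ y in B, g ‖x - y‖))) ^ k ≤
      ∫ x : Fin k → EuclideanSpace ℝ (Fin 2),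
        Real.exp (-(lam * ∫ y in B, (1 - ∏ i, (1 - g ‖y - x i‖))))
        ∂(Measure.pi fun _ => volume.restrict B) := by
  have hfin : IsFiniteMeasure (volume.restrict B) := isFiniteMeasure_restrict.2 hBfin.ne
  have hg (x y : EuclideanSpace ℝ (Fin 2)) : g ‖x - y‖ ∈ Set.Icc (0 : ℝ) 1 :=
    hrange _ (norm_nonneg _)
  have hint (x : EuclideanSpace ℝ (Fin 2)) :
      Integrable (fun y => g ‖y - x‖) (volume.restrict B) :=
    integrable_of_measurable_of_mem_Icc (by fun_prop) fun y => hg y x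
  have hpow := integral_fintype_prod_eq_pow (ι := Fin k) (μ := volume.restrict B)
    fun x => Real.exp (-(lam * ∫ y in B, g ‖x - y‖))
  rw [Fintype.card_fin] at hpow
  rw [← hpow]
  refine integral_mono (Integrable.fintype_prod fun _ =>
    integrable_exp_neg_mul_integral hlam.le (by unfold Function.uncurry; fun_prop)
      fun x y => (hg x y).1)
    (integrable_exp_neg_mul_integral hlam.le (by unfold Function.uncurry; fun_prop)
      fun x y => (one_sub_prod_one_sub_mem_Icc _ _ fun i => hg y (x i)).1) fun x => ?_
  dsimp only
  rw [← Real.exp_sum, Real.exp_le_exp, Finset.sum_neg_distrib, ← Finset.mul_sum]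
  refine neg_le_neg (mul_le_mul_of_nonneg_left ?_ hlam.le)
  simp_rw [norm_sub_rev (x _)]
  rw [← integral_finsetSum _ fun i _ => hint (x i)]
  exact integral_mono
    (integrable_of_measurable_of_mem_Icc (by fun_prop) fun y =>
      one_sub_prod_one_sub_mem_Icc _ _ fun i => hg y (x i))
    (integrable_finsetSum _ fun i _ => hint (x i))
    fun y => one_sub_prod_one_sub_le_sum _ _ fun i => hg y (x i)
end

section
/- Let g : [0,∞) → [0,1] be non-increasing with 0 < C := ∫_{ℝ²} g(‖x‖) dx < ∞ and with g(x) = o(1/(x² log² x)) as x → ∞, and let b ∈ ℝ. Then lim_{ρ→∞} λ_ρ · ∫_{A_ρ} exp(− λ_ρ ∫_{A_ρ} g(‖x − y‖) dy) dx = e^{−b}, where λ_ρ := (log ρ + b)/C, r_ρ := √((log ρ + b)/(C ρ)) and A_ρ := [−1/(2 r_ρ), 1/(2 r_ρ)]². -/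
open MeasureTheory Real Filter Asymptotics

/-- `C = ∫_{ℝ²} g(‖x‖) dx`. -/
noncomputable def Cg (g : ℝ → ℝ) : ℝ := ∫ x : EuclideanSpace ℝ (Fin 2), g ‖x‖

/-- `λ_ρ = (log ρ + b)/C`. -/
noncomputable def lamDen (g : ℝ → ℝ) (b ρ : ℝ) : ℝ := (Real.log ρ + b) / Cg g

/-- `r_ρ = √((log ρ + b)/(C ρ))`. -/
noncomputable def rRho (g : ℝ → ℝ) (b ρ : ℝ) : ℝ :=
  Real.sqrt ((Real.log ρ + b) / (Cg g * ρ))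

/-- The square `A_ρ = [−1/(2 r_ρ), 1/(2 r_ρ)]² ⊂ ℝ²`. -/
def sqA (g : ℝ → ℝ) (b ρ : ℝ) : Set (EuclideanSpace ℝ (Fin 2)) :=
  {x | ∀ i, x i ∈ Set.Icc (-(1 / (2 * rRho g b ρ))) (1 / (2 * rRho g b ρ))}

/-- The radial profile `g` as a function of Cartesian coordinates in the plane. -/
noncomputable def planarProfile (g : ℝ → ℝ) (s t : ℝ) : ℝ := g (√(s ^ 2 + t ^ 2))

/-- The mass of the rectangle `[0, u] × [0, v]` under the radial profile `g`. -/
noncomputable def quadrantMass (g : ℝ → ℝ) (u v : ℝ) : ℝ :=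
  ∫ s in (0 : ℝ)..u, ∫ t in (0 : ℝ)..v, planarProfile g s t

/-- The square `[-a, a]²` in the Euclidean plane. -/
def centeredSquare (a : ℝ) : Set (EuclideanSpace ℝ (Fin 2)) :=
  {x | ∀ i, x i ∈ Set.Icc (-a) a}

/-- The coordinate pair of a point of the Euclidean plane. -/
def planeCoords (x : EuclideanSpace ℝ (Fin 2)) : ℝ × ℝ := (x 0, x 1)

theorem measurePreserving_planeCoords : MeasurePreserving planeCoords :=
  (volume_preserving_finTwoArrow ℝ).comp (PiLp.volume_preserving_ofLp (Fin 2))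

theorem measurableEmbedding_planeCoords : MeasurableEmbedding planeCoords :=
  (MeasurableEquiv.finTwoArrow (α := ℝ)).measurableEmbedding.comp
    (MeasurableEquiv.toLp 2 (Fin 2 → ℝ)).symm.measurableEmbedding

theorem preimage_planeCoords_square (a : ℝ) :
    planeCoords ⁻¹' (Set.Icc (-a) a ×ˢ Set.Icc (-a) a) = centeredSquare a := by
  ext x
  simp [centeredSquare, planeCoords, Fin.forall_fin_two, and_and_and_comm]

theorem setIntegral_centeredSquare (a : ℝ) (f : ℝ × ℝ → ℝ) :
    ∫ x in centeredSquare a, f (x 0, x 1) =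
      ∫ p in Set.Icc (-a) a ×ˢ Set.Icc (-a) a, f p := by
  rw [← measurePreserving_planeCoords.setIntegral_preimage_emb measurableEmbedding_planeCoords,
    preimage_planeCoords_square]
  rfl

theorem measurableSet_centeredSquare (a : ℝ) : MeasurableSet (centeredSquare a) := by
  rw [← preimage_planeCoords_square]
  exact measurableEmbedding_planeCoords.measurable (measurableSet_Icc.prod measurableSet_Icc)

theorem norm_sub_eq_sqrt_coords (x y : EuclideanSpace ℝ (Fin 2)) :
    ‖x - y‖ = √((x 0 - y 0) ^ 2 + (x 1 - y 1) ^ 2) := by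
  simp [EuclideanSpace.norm_eq, Fin.sum_univ_two]

theorem planarProfile_mem_Icc {g : ℝ → ℝ}
    (hrange : ∀ x ∈ Set.Ici (0 : ℝ), g x ∈ Set.Icc (0 : ℝ) 1) (s t : ℝ) :
    planarProfile g s t ∈ Set.Icc (0 : ℝ) 1 :=
  hrange _ (Real.sqrt_nonneg _)

theorem measurable_planarProfile {g : ℝ → ℝ} (hmono : AntitoneOn g (Set.Ici (0 : ℝ))) :
    Measurable fun p : ℝ × ℝ => planarProfile g p.1 p.2 := by
  have hanti : Antitone fun r : ℝ => g (max 0 r) := fun r r' h =>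
    hmono (Set.mem_Ici.2 (le_max_left _ _)) (Set.mem_Ici.2 (le_max_left _ _)) (max_le_max le_rfl h)
  have heq : (fun p : ℝ × ℝ => planarProfile g p.1 p.2) =
      (fun r : ℝ => g (max 0 r)) ∘ fun p : ℝ × ℝ => √(p.1 ^ 2 + p.2 ^ 2) := by
    ext p
    simp [planarProfile]
  rw [heq]
  exact hanti.measurable.comp (by fun_prop)

theorem intervalIntegrable_of_abs_le {f : ℝ → ℝ} (hf : Measurable f) {K : ℝ}
    (hK : ∀ x, |f x| ≤ K) (u v : ℝ) : IntervalIntegrable f volume u v :=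
  (intervalIntegrable_const (c := K)).mono_fun hf.aestronglyMeasurable
    (ae_of_all _ fun x => by simpa using (hK x).trans (le_abs_self K))

theorem intervalIntegrable_planarProfile {g : ℝ → ℝ} (hmono : AntitoneOn g (Set.Ici (0 : ℝ)))
    (hrange : ∀ x ∈ Set.Ici (0 : ℝ), g x ∈ Set.Icc (0 : ℝ) 1) (s u v : ℝ) :
    IntervalIntegrable (planarProfile g s) volume u v :=
  intervalIntegrable_of_abs_le
    ((measurable_planarProfile hmono).comp (measurable_const.prodMk measurable_id)) (K := 1)
    (fun t => abs_le.2 ⟨neg_one_lt_zero.le.trans (planarProfile_mem_Icc hrange s t).1,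
      (planarProfile_mem_Icc hrange s t).2⟩) u v

theorem intervalIntegrable_integral_planarProfile {g : ℝ → ℝ}
    (hmono : AntitoneOn g (Set.Ici (0 : ℝ)))
    (hrange : ∀ x ∈ Set.Ici (0 : ℝ), g x ∈ Set.Icc (0 : ℝ) 1) (w u v : ℝ) :
    IntervalIntegrable (fun s => ∫ t in (0 : ℝ)..w, planarProfile g s t) volume u v := by
  refine intervalIntegrable_of_abs_le ?_ (K := |w|) (fun s => ?_) u v
  · simp only [intervalIntegral.intervalIntegral_eq_integral_uIoc, smul_eq_mul]
    exact ((measurable_planarProfile hmono).stronglyMeasurable.integral_prod_right'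
      (ν := volume.restrict (Set.uIoc 0 w))).measurable.const_mul _
  · have := intervalIntegral.norm_integral_le_of_norm_le_const (a := (0 : ℝ)) (b := w) (C := 1)
      (f := planarProfile g s) fun t _ => by
        rw [Real.norm_eq_abs, abs_of_nonneg (planarProfile_mem_Icc hrange s t).1]
        exact (planarProfile_mem_Icc hrange s t).2
    simpa using this

theorem intervalIntegral_of_even {f : ℝ → ℝ} (heven : ∀ x, f (-x) = f x)
    (hf : ∀ u v, IntervalIntegrable f volume u v) (p q : ℝ) :
    ∫ x in (-p)..q, f x = (∫ x in (0 : ℝ)..p, f x) + ∫ x in (0 : ℝ)..q, f x := by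
  rw [← intervalIntegral.integral_add_adjacent_intervals (hf (-p) 0) (hf 0 q)]
  congr 1
  have := intervalIntegral.integral_comp_neg (a := 0) (b := p) f
  simp only [heven, neg_zero] at this
  exact this.symm

theorem quadrantMass_mono_left {g : ℝ → ℝ} (hmono : AntitoneOn g (Set.Ici (0 : ℝ)))
    (hrange : ∀ x ∈ Set.Ici (0 : ℝ), g x ∈ Set.Icc (0 : ℝ) 1) {u u' v : ℝ}
    (hu : 0 ≤ u) (huu : u ≤ u') (hv : 0 ≤ v) :
    quadrantMass g u v ≤ quadrantMass g u' v :=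
  intervalIntegral.integral_mono_interval le_rfl hu huu
    (ae_of_all _ fun s => intervalIntegral.integral_nonneg hv
      fun t _ => (planarProfile_mem_Icc hrange s t).1)
    (intervalIntegrable_integral_planarProfile hmono hrange v 0 u')

theorem quadrantMass_mono_right {g : ℝ → ℝ} (hmono : AntitoneOn g (Set.Ici (0 : ℝ)))
    (hrange : ∀ x ∈ Set.Ici (0 : ℝ), g x ∈ Set.Icc (0 : ℝ) 1) {u v v' : ℝ}
    (hu : 0 ≤ u) (hv : 0 ≤ v) (hvv : v ≤ v') :
    quadrantMass g u v ≤ quadrantMass g u v' :=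
  intervalIntegral.integral_mono hu
    (intervalIntegrable_integral_planarProfile hmono hrange v 0 u)
    (intervalIntegrable_integral_planarProfile hmono hrange v' 0 u)
    fun s => intervalIntegral.integral_mono_interval le_rfl hv hvv
      (ae_of_all _ fun t => (planarProfile_mem_Icc hrange s t).1)
      (intervalIntegrable_planarProfile hmono hrange s 0 v')

theorem quadrantMass_mono {g : ℝ → ℝ} (hmono : AntitoneOn g (Set.Ici (0 : ℝ)))
    (hrange : ∀ x ∈ Set.Ici (0 : ℝ), g x ∈ Set.Icc (0 : ℝ) 1) {u u' v v' : ℝ}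
    (hu : 0 ≤ u) (huu : u ≤ u') (hv : 0 ≤ v) (hvv : v ≤ v') :
    quadrantMass g u v ≤ quadrantMass g u' v' :=
  (quadrantMass_mono_left hmono hrange hu huu hv).trans
    (quadrantMass_mono_right hmono hrange (hu.trans huu) hv hvv)

theorem quadrantMass_nonneg {g : ℝ → ℝ}
    (hrange : ∀ x ∈ Set.Ici (0 : ℝ), g x ∈ Set.Icc (0 : ℝ) 1) {u v : ℝ}
    (hu : 0 ≤ u) (hv : 0 ≤ v) : 0 ≤ quadrantMass g u v :=
  intervalIntegral.integral_nonneg hu fun s _ => intervalIntegral.integral_nonneg hv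
    fun t _ => (planarProfile_mem_Icc hrange s t).1

theorem quadrantMass_comm {g : ℝ → ℝ} (hmono : AntitoneOn g (Set.Ici (0 : ℝ)))
    (hrange : ∀ x ∈ Set.Ici (0 : ℝ), g x ∈ Set.Icc (0 : ℝ) 1) (u v : ℝ) :
    quadrantMass g u v = quadrantMass g v u := by
  unfold quadrantMass
  rw [intervalIntegral_intervalIntegral_swap]
  · simp only [planarProfile, add_comm]
  · refine Measure.integrableOn_of_bounded (M := 1) ?_
      (measurable_planarProfile hmono).aestronglyMeasurable (ae_of_all _ fun p => ?_)
    · simp [Measure.volume_eq_prod, Measure.prod_prod, ENNReal.mul_eq_top, Set.uIoc]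
    · rw [Real.norm_eq_abs, Function.uncurry]
      exact abs_le.2 ⟨by linarith [(planarProfile_mem_Icc hrange p.1 p.2).1],
        (planarProfile_mem_Icc hrange p.1 p.2).2⟩

theorem mul_le_quadrantMass {g : ℝ → ℝ} (hmono : AntitoneOn g (Set.Ici (0 : ℝ)))
    (hrange : ∀ x ∈ Set.Ici (0 : ℝ), g x ∈ Set.Icc (0 : ℝ) 1) {u v : ℝ}
    (hu : 0 ≤ u) (hv : 0 ≤ v) : u * v * g (u + v) ≤ quadrantMass g u v := by
  have hin : ∀ s ∈ Set.Icc 0 u, v * g (u + v) ≤ ∫ t in (0 : ℝ)..v, planarProfile g s t := by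
    intro s hs
    have := intervalIntegral.integral_mono_on hv (intervalIntegrable_const (c := g (u + v)))
      (intervalIntegrable_planarProfile hmono hrange s 0 v) fun t ht =>
        hmono (Real.sqrt_nonneg _) (add_nonneg hu hv) (by
          refine Real.sqrt_le_iff.2 ⟨by positivity, ?_⟩
          nlinarith [hs.1, hs.2, ht.1, ht.2, mul_nonneg hu hv])
    simpa using this
  have := intervalIntegral.integral_mono_on hu
    (intervalIntegrable_const (c := v * g (u + v)))
    (intervalIntegrable_integral_planarProfile hmono hrange v 0 u) hin
  simpa only [quadrantMass, intervalIntegral.integral_const, sub_zero, smul_eq_mul,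
    mul_assoc] using this

/-- The mass seen from the point `(s, t)` inside the square `[-a, a]²`, as the sum of the masses
of the four rectangles into which the axes through the point cut the square. -/
noncomputable def squareMass (g : ℝ → ℝ) (a s t : ℝ) : ℝ :=
  quadrantMass g (a + s) (a + t) + quadrantMass g (a + s) (a - t) +
    quadrantMass g (a - s) (a + t) + quadrantMass g (a - s) (a - t)

theorem setIntegral_centeredSquare_norm_sub {g : ℝ → ℝ} (hmono : AntitoneOn g (Set.Ici (0 : ℝ)))
    (hrange : ∀ x ∈ Set.Ici (0 : ℝ), g x ∈ Set.Icc (0 : ℝ) 1) {a : ℝ} (ha : 0 ≤ a)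
    (x : EuclideanSpace ℝ (Fin 2)) :
    ∫ y in centeredSquare a, g ‖x - y‖ = squareMass g a (x 0) (x 1) := by
  have hle : -a ≤ a := by linarith
  simp only [norm_sub_eq_sqrt_coords]
  change ∫ y in centeredSquare a, planarProfile g (x 0 - y 0) (x 1 - y 1) = _
  rw [setIntegral_centeredSquare a fun p => planarProfile g (x 0 - p.1) (x 1 - p.2),
    Measure.volume_eq_prod, setIntegral_prod]
  · simp only [integral_Icc_eq_integral_Ioc, ← intervalIntegral.integral_of_le hle,
      fun s => intervalIntegral.integral_comp_sub_left (a := -a) (b := a)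
        (planarProfile g s) (x 1)]
    rw [intervalIntegral.integral_comp_sub_left
      (fun s => ∫ t in (x 1 - a)..(x 1 - -a), planarProfile g s t)]
    have h0 : x 0 - a = -(a - x 0) := by ring
    have h1 : x 1 - a = -(a - x 1) := by ring
    have h2 : ∀ i, x i - -a = a + x i := fun i => by ring
    have hin : ∀ s, ∫ t in (-(a - x 1))..(a + x 1), planarProfile g s t =
        (∫ t in (0 : ℝ)..(a - x 1), planarProfile g s t) +
          ∫ t in (0 : ℝ)..(a + x 1), planarProfile g s t := fun s =>
      intervalIntegral_of_even (fun t => by simp [planarProfile])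
        (intervalIntegrable_planarProfile hmono hrange s) _ _
    have hint := intervalIntegrable_integral_planarProfile hmono hrange
    simp only [h0, h1, h2, hin]
    rw [intervalIntegral.integral_add (hint _ _ _) (hint _ _ _),
      intervalIntegral_of_even (fun t => by simp [planarProfile]) (hint _),
      intervalIntegral_of_even (fun t => by simp [planarProfile]) (hint _)]
    simp only [squareMass, quadrantMass]
    ring
  · refine Measure.integrableOn_of_bounded (M := 1) ?_
      ((measurable_planarProfile hmono).comp
        (f := fun p : ℝ × ℝ => (x 0 - p.1, x 1 - p.2)) (by fun_prop)).aestronglyMeasurable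
      (ae_of_all _ fun p => ?_)
    · rw [Measure.prod_prod]
      exact ENNReal.mul_ne_top (by simp) (by simp)
    · have := planarProfile_mem_Icc hrange (x 0 - p.1) (x 1 - p.2)
      rw [Real.norm_eq_abs]
      exact abs_le.2 ⟨by linarith [this.1], this.2⟩

theorem squareMass_le_Cg {g : ℝ → ℝ} (hmono : AntitoneOn g (Set.Ici (0 : ℝ)))
    (hrange : ∀ x ∈ Set.Ici (0 : ℝ), g x ∈ Set.Icc (0 : ℝ) 1)
    (hint : Integrable (fun x : EuclideanSpace ℝ (Fin 2) => g ‖x‖)) {a : ℝ} (ha : 0 ≤ a)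
    (x : EuclideanSpace ℝ (Fin 2)) : squareMass g a (x 0) (x 1) ≤ Cg g := by
  rw [← setIntegral_centeredSquare_norm_sub hmono hrange ha x, Cg,
    ← integral_sub_left_eq_self (fun y => g ‖y‖) volume x]
  exact setIntegral_le_integral (hint.comp_sub_left x)
    (ae_of_all _ fun y => (hrange _ (norm_nonneg _)).1)

theorem exists_pos_of_Cg_pos {g : ℝ → ℝ}
    (hrange : ∀ x ∈ Set.Ici (0 : ℝ), g x ∈ Set.Icc (0 : ℝ) 1) (hpos : 0 < Cg g) :
    ∃ t, 0 < t ∧ 0 < g t := by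
  by_contra! h
  refine hpos.ne' (integral_eq_zero_of_ae ?_)
  filter_upwards [compl_mem_ae_iff.2 (measure_singleton (0 : EuclideanSpace ℝ (Fin 2)))]
    with x hx
  exact le_antisymm (h _ (norm_pos_iff.2 hx)) (hrange _ (norm_nonneg _)).1

theorem integrableOn_and_integral_Ioi_one_div_mul_log_sq {d : ℝ} (hd : 1 < d) :
    IntegrableOn (fun y : ℝ => 1 / (y * Real.log y ^ 2)) (Set.Ioi d) ∧
      ∫ y in Set.Ioi d, 1 / (y * Real.log y ^ 2) = 1 / Real.log d := by
  have hderiv : ∀ y ∈ Set.Ici d,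
      HasDerivAt (fun y => -(Real.log y)⁻¹) (1 / (y * Real.log y ^ 2)) y := by
    intro y hy
    have hy1 : 1 < y := hd.trans_le hy
    have hlog := (Real.log_pos hy1).ne'
    refine ((Real.hasDerivAt_log (by positivity : y ≠ 0)).inv hlog).neg.congr_deriv ?_
    field_simp
  have hnonneg : ∀ y ∈ Set.Ioi d, 0 ≤ 1 / (y * Real.log y ^ 2) := fun y hy => by
    have : 0 < y := by linarith [Set.mem_Ioi.1 hy]
    positivity
  have hlim : Tendsto (fun y => -(Real.log y)⁻¹) atTop (nhds 0) := by
    simpa using (tendsto_inv_atTop_zero.comp Real.tendsto_log_atTop).neg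
  refine ⟨integrableOn_Ioi_deriv_of_nonneg' hderiv hnonneg hlim, ?_⟩
  rw [integral_Ioi_of_hasDerivAt_of_nonneg' hderiv hnonneg hlim]
  simp

theorem Cg_sub_quadrantMass_le {g : ℝ → ℝ} (hmono : AntitoneOn g (Set.Ici (0 : ℝ)))
    (hrange : ∀ x ∈ Set.Ici (0 : ℝ), g x ∈ Set.Icc (0 : ℝ) 1)
    (hint : Integrable (fun x : EuclideanSpace ℝ (Fin 2) => g ‖x‖)) {d : ℝ} (hd : 0 ≤ d) :
    Cg g - 4 * quadrantMass g d d ≤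
      2 * (volume.real (Metric.ball (0 : EuclideanSpace ℝ (Fin 2)) 1) *
        ∫ y in Set.Ioi d, y * g y) := by
  have hsq := setIntegral_centeredSquare_norm_sub hmono hrange hd 0
  simp only [zero_sub, norm_neg, squareMass, PiLp.zero_apply, add_zero, sub_zero] at hsq
  have hpolar := integral_fun_norm_addHaar (volume : Measure (EuclideanSpace ℝ (Fin 2)))
    ((Set.Ioi d).indicator g)
  have hind : (fun y : ℝ => y * (Set.Ioi d).indicator g y) =
      (Set.Ioi d).indicator fun y => y * g y := by
    ext y
    by_cases hy : y ∈ Set.Ioi d <;> simp [hy]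
  simp only [finrank_euclideanSpace, Fintype.card_fin, Nat.add_one_sub_one, pow_one, smul_eq_mul,
    nsmul_eq_mul, Nat.cast_ofNat, hind] at hpolar
  rw [setIntegral_indicator measurableSet_Ioi, Set.inter_eq_right.2 (Set.Ioi_subset_Ioi hd)]
    at hpolar
  rw [← hpolar]
  have hmeas := measurableSet_centeredSquare d
  have hcompl := integral_add_compl hmeas hint
  have hle : ∫ x in (centeredSquare d)ᶜ, g ‖x‖ ≤
      ∫ x : EuclideanSpace ℝ (Fin 2), (Set.Ioi d).indicator g ‖x‖ := by
    rw [← integral_indicator hmeas.compl]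
    refine integral_mono_of_nonneg
      (ae_of_all _ fun x => Set.indicator_nonneg (fun x _ => (hrange _ (norm_nonneg x)).1) x) ?_
      (ae_of_all _ fun x => ?_)
    · have : (fun x : EuclideanSpace ℝ (Fin 2) => (Set.Ioi d).indicator g ‖x‖) =
          (norm ⁻¹' Set.Ioi d).indicator fun x => g ‖x‖ := by
        ext x
        simp [Set.indicator]
      rw [this]
      exact hint.indicator (measurable_norm measurableSet_Ioi)
    · by_cases hx : x ∈ centeredSquare d
      · simp only [Set.indicator, Set.mem_compl_iff, hx, not_true_eq_false, if_false]
        split_ifs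
        exacts [(hrange _ (norm_nonneg x)).1, le_rfl]
      · have hxd : d < ‖x‖ := by
          by_contra! hle
          exact hx fun i => abs_le.1 ((PiLp.norm_apply_le x i).trans hle)
        simp [Set.indicator, hx, hxd]
  have : Cg g = _ := hcompl.symm
  linarith

theorem eventually_log_mul_Cg_sub_quadrantMass {g : ℝ → ℝ}
    (hmono : AntitoneOn g (Set.Ici (0 : ℝ)))
    (hrange : ∀ x ∈ Set.Ici (0 : ℝ), g x ∈ Set.Icc (0 : ℝ) 1)
    (hint : Integrable (fun x : EuclideanSpace ℝ (Fin 2) => g ‖x‖))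
    (hlittleo : g =o[atTop] fun x : ℝ => 1 / (x ^ 2 * Real.log x ^ 2)) {ε : ℝ} (hε : 0 < ε) :
    ∀ᶠ d in atTop, Real.log d * (Cg g - 4 * quadrantMass g d d) ≤ ε := by
  set K := volume.real (Metric.ball (0 : EuclideanSpace ℝ (Fin 2)) 1)
  have hK : 0 ≤ K := measureReal_nonneg
  set η := ε / (2 * K + 1)
  have hη : 0 < η := by positivity
  obtain ⟨N, hN⟩ := eventually_atTop.1 (hlittleo.def hη)
  filter_upwards [eventually_ge_atTop N, eventually_gt_atTop 1] with d hdN hd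
  obtain ⟨hi, hv⟩ := integrableOn_and_integral_Ioi_one_div_mul_log_sq hd
  have hlog := Real.log_pos hd
  have htail : ∫ y in Set.Ioi d, y * g y ≤ η / Real.log d := by
    have : η / Real.log d = ∫ y in Set.Ioi d, η * (1 / (y * Real.log y ^ 2)) := by
      rw [integral_const_mul, hv]
      ring
    rw [this]
    have hy0 : ∀ y ∈ Set.Ioi d, 0 < y := fun y hy => by linarith [Set.mem_Ioi.1 hy]
    refine integral_mono_of_nonneg ?_ (hi.const_mul η) ?_
    · filter_upwards [ae_restrict_mem measurableSet_Ioi] with y hy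
      exact mul_nonneg (hy0 y hy).le (hrange y (hy0 y hy).le).1
    · filter_upwards [ae_restrict_mem measurableSet_Ioi] with y hy
      have hyp := hy0 y hy
      have hylog : 0 < Real.log y := Real.log_pos (hd.trans hy)
      have hb := hN y (hdN.trans (le_of_lt hy))
      rw [Real.norm_of_nonneg (hrange y hyp.le).1, Real.norm_of_nonneg (by positivity)] at hb
      calc y * g y ≤ y * (η * (1 / (y ^ 2 * Real.log y ^ 2))) := by gcongr
        _ = η * (1 / (y * Real.log y ^ 2)) := by field_simp
  calc Real.log d * (Cg g - 4 * quadrantMass g d d)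
      ≤ Real.log d * (2 * (K * (η / Real.log d))) := by
        have := Cg_sub_quadrantMass_le hmono hrange hint (by linarith : 0 ≤ d)
        gcongr
        exact this.trans (by gcongr)
    _ = 2 * K * η := by field_simp
    _ ≤ (2 * K + 1) * η := by linarith
    _ = ε := by simp only [η]; field_simp

/-- The bound, at distance `p` from an edge of the square, for the contribution of that edge to
the isolation probability. -/
noncomputable def edgeBound (L c w d p : ℝ) : ℝ :=
  rexp (-(L * c * p)) + rexp (1 - L * c * w) * rexp (-(d⁻¹ * p))

theorem one_le_exp_mul_exp {d p : ℝ} (hd : 0 < d) (hp : p ≤ d) :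
    1 ≤ rexp 1 * rexp (-(d⁻¹ * p)) := by
  rw [← Real.exp_add]
  refine Real.one_le_exp ?_
  have : d⁻¹ * p ≤ 1 := by rw [inv_mul_le_iff₀ hd]; linarith
  linarith

theorem exp_neg_quadrantMass_le_edgeBound {g : ℝ → ℝ} (hmono : AntitoneOn g (Set.Ici (0 : ℝ)))
    (hrange : ∀ x ∈ Set.Ici (0 : ℝ), g x ∈ Set.Icc (0 : ℝ) 1) {L w d p : ℝ} (hL : 0 ≤ L)
    (hw : 0 < w) (hwd : w ≤ d) (hp : 0 ≤ p) (hpd : p ≤ d) :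
    rexp (-(L * (2 * quadrantMass g p d))) ≤ edgeBound L (2 * w * g (2 * w)) w d p := by
  have hd : 0 < d := hw.trans_le hwd
  rcases le_total p w with hpw | hwp
  · have h1 := quadrantMass_mono_right hmono hrange hp hw.le hwd
    have h2 := mul_le_quadrantMass hmono hrange hp hw.le
    have h3 : g (2 * w) ≤ g (p + w) :=
      hmono (Set.mem_Ici.2 (by positivity)) (Set.mem_Ici.2 (by positivity)) (by linarith)
    have h4 : p * w * g (2 * w) ≤ p * w * g (p + w) := by gcongr
    refine le_add_of_le_of_nonneg (Real.exp_le_exp.2 (neg_le_neg ?_)) (by positivity)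
    calc L * (2 * w * g (2 * w)) * p = L * (2 * (p * w * g (2 * w))) := by ring
      _ ≤ L * (2 * quadrantMass g p d) := by gcongr; linarith
  · have h1 := quadrantMass_mono hmono hrange hw.le hwp hw.le hwd
    have h2 := mul_le_quadrantMass hmono hrange hw.le hw.le
    rw [← two_mul] at h2
    have h3 : rexp (-(L * (2 * quadrantMass g p d))) ≤
        rexp (-(L * (2 * w * g (2 * w)) * w)) := by
      refine Real.exp_le_exp.2 (neg_le_neg ?_)
      calc L * (2 * w * g (2 * w)) * w = L * (2 * (w * w * g (2 * w))) := by ring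
        _ ≤ L * (2 * quadrantMass g p d) := by gcongr; linarith
    refine le_add_of_nonneg_of_le (by positivity) (h3.trans ?_)
    rw [sub_eq_add_neg, Real.exp_add, mul_comm (rexp 1), mul_assoc (rexp _)]
    exact le_mul_of_one_le_right (Real.exp_nonneg _) (one_le_exp_mul_exp hd hpd)

theorem exp_neg_sum_quadrantMass_le {g : ℝ → ℝ} (hmono : AntitoneOn g (Set.Ici (0 : ℝ)))
    (hrange : ∀ x ∈ Set.Ici (0 : ℝ), g x ∈ Set.Icc (0 : ℝ) 1) {L w d p q r u : ℝ} (hL : 0 ≤ L)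
    (hw : 0 < w) (hwd : w ≤ d) (hp : 0 ≤ p) (hq : 0 ≤ q) (hr : 0 ≤ r) (hu : 0 ≤ u)
    (hpq : d ≤ p ∨ d ≤ q) (hru : d ≤ r ∨ d ≤ u) :
    rexp (-(L * (quadrantMass g p r + quadrantMass g p u + quadrantMass g q r +
        quadrantMass g q u))) ≤
      rexp (-(L * (4 * quadrantMass g d d))) +
      rexp (-(L * (2 * quadrantMass g d d))) *
        ((edgeBound L (2 * w * g (2 * w)) w d p + edgeBound L (2 * w * g (2 * w)) w d q) +
          (edgeBound L (2 * w * g (2 * w)) w d r + edgeBound L (2 * w * g (2 * w)) w d u)) +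
      rexp (-(L * quadrantMass g d d)) *
        ((rexp 1 * rexp (-(d⁻¹ * p)) + rexp 1 * rexp (-(d⁻¹ * q))) *
          (rexp 1 * rexp (-(d⁻¹ * r)) + rexp 1 * rexp (-(d⁻¹ * u)))) := by
  have hd : 0 < d := hw.trans_le hwd
  set m := quadrantMass g d d
  set S := quadrantMass g p r + quadrantMass g p u + quadrantMass g q r + quadrantMass g q u
    with hS
  have hbulk : ∀ {x y}, d ≤ x → d ≤ y → m ≤ quadrantMass g x y := fun hx hy =>
    quadrantMass_mono hmono hrange hd.le hx hd.le hy
  have hright : ∀ {x y}, 0 ≤ x → d ≤ y → quadrantMass g x d ≤ quadrantMass g x y := fun hx hy =>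
    quadrantMass_mono_right hmono hrange hx hd.le hy
  have hleft : ∀ {x y}, 0 ≤ x → d ≤ y → quadrantMass g x d ≤ quadrantMass g y x := fun hx hy =>
    (quadrantMass_comm hmono hrange _ _).trans_le
      (quadrantMass_mono_left hmono hrange hd.le hy hx)
  have hpr := quadrantMass_nonneg hrange hp hr
  have hpu := quadrantMass_nonneg hrange hp hu
  have hqr := quadrantMass_nonneg hrange hq hr
  have hqu := quadrantMass_nonneg hrange hq hu
  have hpos : ∀ x, 0 ≤ edgeBound L (2 * w * g (2 * w)) w d x := fun x => by
    unfold edgeBound; positivity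
  have hmain : 4 * m ≤ S → rexp (-(L * S)) ≤ rexp (-(L * (4 * m))) := fun h =>
    Real.exp_le_exp.2 (neg_le_neg (by gcongr))
  have hedge : ∀ {x}, 0 ≤ x → x ≤ d → 2 * m + 2 * quadrantMass g x d ≤ S →
      rexp (-(L * S)) ≤ rexp (-(L * (2 * m))) * edgeBound L (2 * w * g (2 * w)) w d x := by
    intro x hx hxd h
    calc rexp (-(L * S)) ≤ rexp (-(L * (2 * m + 2 * quadrantMass g x d))) :=
          Real.exp_le_exp.2 (neg_le_neg (by gcongr))
      _ = rexp (-(L * (2 * m))) * rexp (-(L * (2 * quadrantMass g x d))) := by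
          rw [← Real.exp_add]; ring_nf
      _ ≤ _ := by
          gcongr
          exact exp_neg_quadrantMass_le_edgeBound hmono hrange hL hw hwd hx hxd
  have hedges : ∀ {x A D}, 0 ≤ A → 0 ≤ D → 0 ≤ x → x ≤ d → 2 * m + 2 * quadrantMass g x d ≤ S →
      edgeBound L (2 * w * g (2 * w)) w d x ≤
        (edgeBound L (2 * w * g (2 * w)) w d p + edgeBound L (2 * w * g (2 * w)) w d q) +
          (edgeBound L (2 * w * g (2 * w)) w d r + edgeBound L (2 * w * g (2 * w)) w d u) →
      rexp (-(L * S)) ≤ A + rexp (-(L * (2 * m))) *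
        ((edgeBound L (2 * w * g (2 * w)) w d p + edgeBound L (2 * w * g (2 * w)) w d q) +
          (edgeBound L (2 * w * g (2 * w)) w d r + edgeBound L (2 * w * g (2 * w)) w d u)) + D :=
    fun hA hD hx hxd h hle =>
      (((hedge hx hxd h).trans (mul_le_mul_of_nonneg_left hle (Real.exp_nonneg _))).trans
        (le_add_of_nonneg_left hA)).trans (le_add_of_nonneg_right hD)
  have hP := hpos p
  have hQ := hpos q
  have hR := hpos r
  have hU := hpos u
  by_cases h1 : d ≤ p ∧ d ≤ q
  · by_cases h2 : d ≤ r ∧ d ≤ u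
    · have := hbulk h1.1 h2.1
      have := hbulk h1.1 h2.2
      have := hbulk h1.2 h2.1
      have := hbulk h1.2 h2.2
      rw [add_assoc]
      exact le_add_of_le_of_nonneg (hmain (by linarith)) (by positivity)
    · rcases not_and_or.1 h2 with hlt | hlt
      · have hu' := hru.resolve_left hlt
        have := hbulk h1.1 hu'
        have := hbulk h1.2 hu'
        have := hleft hr h1.1
        have := hleft hr h1.2
        exact hedges (Real.exp_nonneg _) (by positivity) hr (not_le.1 hlt).le (by linarith)
          (by linarith)
      · have hr' := hru.resolve_right hlt
        have := hbulk h1.1 hr'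
        have := hbulk h1.2 hr'
        have := hleft hu h1.1
        have := hleft hu h1.2
        exact hedges (Real.exp_nonneg _) (by positivity) hu (not_le.1 hlt).le (by linarith)
          (by linarith)
  · by_cases h2 : d ≤ r ∧ d ≤ u
    · rcases not_and_or.1 h1 with hlt | hlt
      · have hq' := hpq.resolve_left hlt
        have := hbulk hq' h2.1
        have := hbulk hq' h2.2
        have := hright hp h2.1
        have := hright hp h2.2
        exact hedges (Real.exp_nonneg _) (by positivity) hp (not_le.1 hlt).le (by linarith)
          (by linarith)
      · have hp' := hpq.resolve_right hlt
        have := hbulk hp' h2.1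
        have := hbulk hp' h2.2
        have := hright hq h2.1
        have := hright hq h2.2
        exact hedges (Real.exp_nonneg _) (by positivity) hq (not_le.1 hlt).le (by linarith)
          (by linarith)
    · have hmS : m ≤ S := by
        rcases hpq with h | h <;> rcases hru with h' | h' <;> linarith [hbulk h h']
      have hcorner : ∀ {x y}, ¬(d ≤ x ∧ d ≤ y) →
          1 ≤ rexp 1 * rexp (-(d⁻¹ * x)) + rexp 1 * rexp (-(d⁻¹ * y)) := by
        intro x y h
        rcases not_and_or.1 h with hlt | hlt
        · exact le_add_of_le_of_nonneg (one_le_exp_mul_exp hd (not_le.1 hlt).le) (by positivity)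
        · exact le_add_of_nonneg_of_le (by positivity) (one_le_exp_mul_exp hd (not_le.1 hlt).le)
      refine le_add_of_nonneg_of_le (by positivity) ?_
      calc rexp (-(L * S)) ≤ rexp (-(L * m)) := Real.exp_le_exp.2 (neg_le_neg (by gcongr))
        _ ≤ _ := le_mul_of_one_le_right (Real.exp_nonneg _)
          (one_le_mul_of_one_le_of_one_le (hcorner h1) (hcorner h2))

theorem setIntegral_exp_neg_mul_add_le {κ a : ℝ} (hκ : 0 < κ) :
    ∫ s in Set.Icc (-a) a, (rexp (-(κ * (a + s))) + rexp (-(κ * (a - s)))) ≤ 2 / κ := by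
  rcases lt_or_ge a 0 with ha | ha
  · rw [Set.Icc_eq_empty (by linarith)]
    have : 0 ≤ 2 / κ := by positivity
    simpa
  have hle : -a ≤ a := by linarith
  have hexp : ∫ x in (0 : ℝ)..(a + a), rexp (-(κ * x)) ≤ 1 / κ := by
    have : ∀ x, HasDerivAt (fun x => -(rexp (-(κ * x)) / κ)) (rexp (-(κ * x))) x := fun x => by
      refine ((((hasDerivAt_id x).const_mul κ).neg.exp).div_const κ).neg.congr_deriv ?_
      simp
      field_simp
    rw [intervalIntegral.integral_eq_sub_of_hasDerivAt (fun x _ => this x)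
      (Continuous.intervalIntegrable (by fun_prop) _ _)]
    have : 0 ≤ rexp (-(κ * (a + a))) / κ := by positivity
    simp only [mul_zero, neg_zero, Real.exp_zero]
    linarith
  rw [integral_Icc_eq_integral_Ioc, ← intervalIntegral.integral_of_le hle,
    intervalIntegral.integral_add (Continuous.intervalIntegrable (by fun_prop) _ _)
      (Continuous.intervalIntegrable (by fun_prop) _ _),
    intervalIntegral.integral_comp_add_left (fun x => rexp (-(κ * x))),
    intervalIntegral.integral_comp_sub_left (fun x => rexp (-(κ * x)))]
  simp only [add_neg_cancel, sub_self, sub_neg_eq_add]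
  calc _ ≤ 1 / κ + 1 / κ := add_le_add hexp hexp
    _ = 2 / κ := by ring

theorem setIntegral_square_add_mul {a : ℝ} (ha : 0 ≤ a) {f h : ℝ → ℝ} (hf : Continuous f)
    (hh : Continuous h) (A B D : ℝ) :
    IntegrableOn (fun p : ℝ × ℝ => A + B * (f p.1 + f p.2) + D * (h p.1 * h p.2))
        (Set.Icc (-a) a ×ˢ Set.Icc (-a) a) ∧
      ∫ p in Set.Icc (-a) a ×ˢ Set.Icc (-a) a,
          (A + B * (f p.1 + f p.2) + D * (h p.1 * h p.2)) =
        (2 * a) ^ 2 * A + B * (4 * a * ∫ s in Set.Icc (-a) a, f s) +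
          D * (∫ s in Set.Icc (-a) a, h s) ^ 2 := by
  have hcont : ∀ F : ℝ × ℝ → ℝ, Continuous F →
      IntegrableOn F (Set.Icc (-a) a ×ˢ Set.Icc (-a) a) := fun F hF =>
    hF.continuousOn.integrableOn_compact (isCompact_Icc.prod isCompact_Icc)
  refine ⟨hcont _ (by fun_prop), ?_⟩
  have hconst : ∀ c : ℝ, ∫ _ in Set.Icc (-a) a, c = 2 * a * c := by
    intro c
    rw [setIntegral_const, Real.volume_real_Icc_of_le (by linarith), smul_eq_mul]
    ring
  have hone : ∫ _ in Set.Icc (-a) a, (1 : ℝ) = 2 * a := by rw [hconst, mul_one]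
  have h1 : ∫ p in Set.Icc (-a) a ×ˢ Set.Icc (-a) a, f p.1 =
      (∫ s in Set.Icc (-a) a, f s) * (2 * a) := by
    have := setIntegral_prod_mul (μ := volume) (ν := volume) f (fun _ : ℝ => (1 : ℝ))
      (Set.Icc (-a) a) (Set.Icc (-a) a)
    simpa only [Measure.volume_eq_prod, mul_one, hone] using this
  have h2 : ∫ p in Set.Icc (-a) a ×ˢ Set.Icc (-a) a, f p.2 =
      (2 * a) * ∫ s in Set.Icc (-a) a, f s := by
    have := setIntegral_prod_mul (μ := volume) (ν := volume) (fun _ : ℝ => (1 : ℝ)) f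
      (Set.Icc (-a) a) (Set.Icc (-a) a)
    simpa only [Measure.volume_eq_prod, one_mul, hone] using this
  have h3 : ∫ p in Set.Icc (-a) a ×ˢ Set.Icc (-a) a, h p.1 * h p.2 =
      (∫ s in Set.Icc (-a) a, h s) * ∫ s in Set.Icc (-a) a, h s :=
    setIntegral_prod_mul (μ := volume) (ν := volume) h h _ _
  have h4 : ∫ _ in Set.Icc (-a) a ×ˢ Set.Icc (-a) a, A = (2 * a) * (2 * a) * A := by
    have := setIntegral_prod_mul (μ := volume) (ν := volume) (fun _ : ℝ => (1 : ℝ))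
      (fun _ : ℝ => A) (Set.Icc (-a) a) (Set.Icc (-a) a)
    simpa only [Measure.volume_eq_prod, one_mul, hone, hconst, mul_assoc] using this
  rw [integral_add (hcont _ (by fun_prop)) (hcont _ (by fun_prop)),
    integral_add (hcont _ (by fun_prop)) (hcont _ (by fun_prop)), integral_const_mul,
    integral_const_mul, integral_add (hcont _ (by fun_prop)) (hcont _ (by fun_prop)), h1,
    h2, h3, h4]
  ring

theorem setIntegral_exp_neg_squareMass_le {g : ℝ → ℝ} (hmono : AntitoneOn g (Set.Ici (0 : ℝ)))
    (hrange : ∀ x ∈ Set.Ici (0 : ℝ), g x ∈ Set.Icc (0 : ℝ) 1) {L w d a : ℝ} (hL : 0 < L)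
    (hw : 0 < w) (hg : 0 < g (2 * w)) (hwd : w ≤ d) (hda : d ≤ a) :
    ∫ p in Set.Icc (-a) a ×ˢ Set.Icc (-a) a, rexp (-(L * squareMass g a p.1 p.2)) ≤
      (2 * a) ^ 2 * rexp (-(L * (4 * quadrantMass g d d))) +
        rexp (-(L * (2 * quadrantMass g d d))) *
          (4 * a * (2 / (L * (2 * w * g (2 * w))) +
            rexp (1 - L * (2 * w * g (2 * w)) * w) * (2 * d))) +
        rexp (-(L * quadrantMass g d d)) * (rexp 1 * (2 * d)) ^ 2 := by
  have hd : 0 < d := hw.trans_le hwd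
  have ha : 0 < a := hd.trans_le hda
  set c := 2 * w * g (2 * w)
  have hcpos : 0 < c := by positivity
  set m := quadrantMass g d d
  let f : ℝ → ℝ := fun s => edgeBound L c w d (a + s) + edgeBound L c w d (a - s)
  let h : ℝ → ℝ := fun s => rexp 1 * rexp (-(d⁻¹ * (a + s))) + rexp 1 * rexp (-(d⁻¹ * (a - s)))
  have hf : Continuous f := by unfold f edgeBound; fun_prop
  have hh : Continuous h := by unfold h; fun_prop
  have hexp : ∀ κ, IntegrableOn (fun s => rexp (-(κ * (a + s))) + rexp (-(κ * (a - s))))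
      (Set.Icc (-a) a) := fun κ => Continuous.integrableOn_Icc (by fun_prop)
  have hd2 : ∫ s in Set.Icc (-a) a, (rexp (-(d⁻¹ * (a + s))) + rexp (-(d⁻¹ * (a - s)))) ≤
      2 * d := by
    simpa using setIntegral_exp_neg_mul_add_le (a := a) (inv_pos.2 hd)
  have hf_int : ∫ s in Set.Icc (-a) a, f s ≤ 2 / (L * c) + rexp (1 - L * c * w) * (2 * d) := by
    have : f = fun s => (rexp (-(L * c * (a + s))) + rexp (-(L * c * (a - s)))) +
        rexp (1 - L * c * w) * (rexp (-(d⁻¹ * (a + s))) + rexp (-(d⁻¹ * (a - s)))) := by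
      ext s
      simp only [f, edgeBound]
      ring
    rw [this, integral_add (hexp _) ((hexp _).const_mul _), integral_const_mul]
    gcongr
    exact setIntegral_exp_neg_mul_add_le (by positivity)
  have hh_int : ∫ s in Set.Icc (-a) a, h s ≤ rexp 1 * (2 * d) := by
    have : h = fun s => rexp 1 * (rexp (-(d⁻¹ * (a + s))) + rexp (-(d⁻¹ * (a - s)))) := by
      ext s
      simp only [h]
      ring
    rw [this, integral_const_mul]
    gcongr
  have hh_nonneg : 0 ≤ ∫ s in Set.Icc (-a) a, h s :=
    integral_nonneg fun s => by simp only [h]; positivity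
  obtain ⟨hi, hv⟩ := setIntegral_square_add_mul ha.le hf hh (rexp (-(L * (4 * m))))
    (rexp (-(L * (2 * m)))) (rexp (-(L * m)))
  calc _ ≤ ∫ p in Set.Icc (-a) a ×ˢ Set.Icc (-a) a, (rexp (-(L * (4 * m))) +
        rexp (-(L * (2 * m))) * (f p.1 + f p.2) + rexp (-(L * m)) * (h p.1 * h p.2)) := by
        refine integral_mono_of_nonneg (ae_of_all _ fun p => Real.exp_nonneg _) hi ?_
        filter_upwards [ae_restrict_mem (measurableSet_Icc.prod measurableSet_Icc)] with p hp
        obtain ⟨⟨h1, h2⟩, h3, h4⟩ := hp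
        have hside : ∀ s : ℝ, d ≤ a + s ∨ d ≤ a - s := fun s => by
          rcases le_total 0 s with hs | hs
          · left; linarith
          · right; linarith
        exact exp_neg_sum_quadrantMass_le hmono hrange hL.le hw hwd (by linarith) (by linarith)
          (by linarith) (by linarith) (hside _) (hside _)
    _ ≤ _ := by
        rw [hv]
        gcongr

theorem mul_exp_neg_le_setIntegral {g : ℝ → ℝ} (hmono : AntitoneOn g (Set.Ici (0 : ℝ)))
    (hrange : ∀ x ∈ Set.Ici (0 : ℝ), g x ∈ Set.Icc (0 : ℝ) 1)
    (hint : Integrable (fun x : EuclideanSpace ℝ (Fin 2) => g ‖x‖)) {L a : ℝ} (hL : 0 ≤ L)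
    (ha : 0 ≤ a) :
    (2 * a) ^ 2 * rexp (-(L * Cg g)) ≤
      ∫ x in centeredSquare a, rexp (-(L * ∫ y in centeredSquare a, g ‖x - y‖)) := by
  have hvol : volume.real (centeredSquare a) = (2 * a) ^ 2 := by
    have h1 := setIntegral_centeredSquare a fun _ => 1
    have h2 := (setIntegral_square_add_mul ha continuous_const (continuous_const (y := (0 : ℝ)))
      1 0 0 (f := fun _ => 0)).2
    simp only [zero_mul, add_zero, mul_one] at h2
    rw [h2] at h1
    simpa using h1
  have hfin : volume (centeredSquare a) ≠ ⊤ := by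
    rw [← preimage_planeCoords_square,
      measurePreserving_planeCoords.measure_preimage_emb measurableEmbedding_planeCoords]
    exact (isCompact_Icc.prod isCompact_Icc).measure_ne_top
  have hnonneg : ∀ x, 0 ≤ ∫ y in centeredSquare a, g ‖x - y‖ := fun x =>
    integral_nonneg fun y => (hrange _ (norm_nonneg _)).1
  have hmeas : StronglyMeasurable fun x => ∫ y in centeredSquare a, g ‖x - y‖ := by
    have : Measurable fun z : EuclideanSpace ℝ (Fin 2) × EuclideanSpace ℝ (Fin 2) =>
        g ‖z.1 - z.2‖ := by
      simp only [norm_sub_eq_sqrt_coords]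
      exact (measurable_planarProfile hmono).comp
        (f := fun z : EuclideanSpace ℝ (Fin 2) × EuclideanSpace ℝ (Fin 2) =>
          (z.1 0 - z.2 0, z.1 1 - z.2 1)) (by fun_prop)
    exact this.stronglyMeasurable.integral_prod_right'
  rw [← hvol, ← smul_eq_mul, ← setIntegral_const]
  refine setIntegral_mono_on (integrableOn_const hfin) ?_ (measurableSet_centeredSquare a)
    fun x _ => ?_
  · refine Measure.integrableOn_of_bounded (M := 1) hfin
      (Real.measurable_exp.comp (hmeas.measurable.const_mul L).neg).aestronglyMeasurable
      (ae_of_all _ fun x => ?_)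
    rw [Real.norm_of_nonneg (Real.exp_nonneg _)]
    exact Real.exp_le_one_iff.2 (neg_nonpos.2 (mul_nonneg hL (hnonneg x)))
  · rw [setIntegral_centeredSquare_norm_sub hmono hrange ha]
    have := squareMass_le_Cg hmono hrange hint ha x
    gcongr

theorem tendsto_boundary_contribution {c w C δ : ℝ} (b : ℝ) (h1 : δ < c * w)
    (h2 : 2 * δ < C / 4) :
    Tendsto (fun L : ℝ => 4 * rexp (-(b / 2)) *
        (c⁻¹ * L ^ (-(1 / 2) : ℝ) +
          rexp 1 * (L ^ (1 / 2 : ℝ) * rexp (-(c * w - δ) * L))) +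
        4 * rexp 1 ^ 2 * (L ^ (1 : ℝ) * rexp (-(C / 4 - 2 * δ) * L)))
      atTop (nhds 0) := by
  have t1 := tendsto_rpow_neg_atTop (y := 1 / 2) (by norm_num)
  have t2 := tendsto_rpow_mul_exp_neg_mul_atTop_nhds_zero (1 / 2) (c * w - δ) (by linarith)
  have t3 := tendsto_rpow_mul_exp_neg_mul_atTop_nhds_zero 1 (C / 4 - 2 * δ) (by linarith)
  have := (((t1.const_mul c⁻¹).add (t2.const_mul (rexp 1))).const_mul
    (4 * rexp (-(b / 2)))).add (t3.const_mul (4 * rexp 1 ^ 2))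
  simp only [mul_zero, add_zero] at this
  exact this

theorem eventually_mul_setIntegral_lt {g : ℝ → ℝ} (hmono : AntitoneOn g (Set.Ici (0 : ℝ)))
    (hrange : ∀ x ∈ Set.Ici (0 : ℝ), g x ∈ Set.Icc (0 : ℝ) 1)
    (hint : Integrable (fun x : EuclideanSpace ℝ (Fin 2) => g ‖x‖)) (hpos : 0 < Cg g)
    (hlittleo : g =o[atTop] fun x : ℝ => 1 / (x ^ 2 * Real.log x ^ 2)) (b : ℝ) {y : ℝ}
    (hy : rexp (-b) < y) :
    ∀ᶠ L in atTop, ∀ a, 0 ≤ a → (2 * a) ^ 2 = rexp (L * Cg g - b) / L →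
      L * ∫ x in centeredSquare a, rexp (-(L * ∫ y in centeredSquare a, g ‖x - y‖)) < y := by
  obtain ⟨t, ht, hgt⟩ := exists_pos_of_Cg_pos hrange hpos
  set C := Cg g
  obtain ⟨w, rfl⟩ : ∃ w, t = 2 * w := ⟨t / 2, by ring⟩
  have hw : 0 < w := by linarith
  set c := 2 * w * g (2 * w)
  have hcpos : 0 < c := by positivity
  obtain ⟨δ, hδ, hδmin⟩ := exists_between (lt_min (mul_pos hcpos hw) (by positivity : 0 < C / 8))
  obtain ⟨hδ1, hδ2⟩ := lt_min_iff.1 hδmin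
  obtain ⟨ε, hε, hεy⟩ : ∃ ε, 0 < ε ∧ rexp ε * rexp (-b) < y := by
    have : Tendsto (fun ε => rexp ε * rexp (-b)) (nhds 0) (nhds (rexp 0 * rexp (-b))) :=
      Continuous.tendsto (by fun_prop) 0
    rw [Real.exp_zero, one_mul] at this
    obtain ⟨ε, h1, h2⟩ := ((this.mono_left nhdsWithin_le_nhds).eventually_lt_const hy).and
      (self_mem_nhdsWithin (s := Set.Ioi 0)) |>.exists
    exact ⟨ε, h2, h1⟩
  have hR := tendsto_boundary_contribution (c := c) (w := w) (C := C) b hδ1 (by linarith)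
  have hlim := ((hR.const_add (rexp (-b))).const_mul (rexp ε)).eventually_lt_const
    (by rwa [add_zero])
  have hdlim : Tendsto (fun L => rexp (δ * L)) atTop atTop :=
    Real.tendsto_exp_atTop.comp (tendsto_id.const_mul_atTop hδ)
  have htail := hdlim.eventually (eventually_log_mul_Cg_sub_quadrantMass hmono hrange hint hlittleo
    (mul_pos hδ hε))
  have hsmall := (tendsto_rpow_mul_exp_neg_mul_atTop_nhds_zero 1 (C - 2 * δ)
    (by linarith)).eventually_lt_const (by positivity : 0 < rexp (-b) / 4)
  filter_upwards [hlim, htail, hsmall, hdlim.eventually_ge_atTop w, eventually_gt_atTop 0]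
    with L hlim htail hsmall hwd hL a ha hsq
  refine lt_of_le_of_lt ?_ hlim
  set d := rexp (δ * L) with hd
  have hd0 : 0 < d := Real.exp_pos _
  rw [Real.log_exp, mul_assoc, mul_le_mul_iff_right₀ hδ] at htail
  set m := quadrantMass g d d
  rw [Real.rpow_one] at hsmall hlim ⊢
  have hda : d ≤ a := by
    have : (2 * d) ^ 2 ≤ (2 * a) ^ 2 := by
      rw [hsq, le_div_iff₀ hL]
      have h1 : rexp (L * C - b) = rexp (-b) * rexp ((C - 2 * δ) * L) * d ^ 2 := by
        rw [hd, ← Real.exp_nat_mul, ← Real.exp_add, ← Real.exp_add]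
        push_cast
        ring_nf
      have h2 : rexp (-(C - 2 * δ) * L) * rexp ((C - 2 * δ) * L) = 1 := by
        rw [← Real.exp_add, Real.exp_eq_one_iff]; ring
      have h3 : 4 * L ≤ rexp (-b) * rexp ((C - 2 * δ) * L) := by
        calc 4 * L = 4 * (L * rexp (-(C - 2 * δ) * L)) * rexp ((C - 2 * δ) * L) := by
              linear_combination (-4 * L) * h2
          _ ≤ rexp (-b) * rexp ((C - 2 * δ) * L) := by gcongr; linarith
      rw [h1]
      calc (2 * d) ^ 2 * L = 4 * L * d ^ 2 := by ring
        _ ≤ _ := by gcongr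
    linarith [(pow_le_pow_iff_left₀ (by positivity) (by positivity) two_ne_zero).1 this]
  have hside : 2 * a * √L = rexp ((L * C - b) / 2) := by
    refine (pow_left_inj₀ (by positivity) (by positivity) two_ne_zero).1 ?_
    rw [mul_pow, Real.sq_sqrt hL.le, hsq, div_mul_cancel₀ _ hL.ne', ← Real.exp_nat_mul]
    push_cast
    ring_nf
  have hs : √L * √L = L := Real.mul_self_sqrt hL.le
  have hs0 : 0 < √L := Real.sqrt_pos.2 hL
  have hinterior : L * (2 * a) ^ 2 * rexp (-(L * C)) = rexp (-b) := by
    rw [hsq, mul_div_cancel₀ _ hL.ne', ← Real.exp_add]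
    ring_nf
  have hedge : L * (2 * a) * rexp (-(L * C / 2)) = √L * rexp (-(b / 2)) := by
    have h1 : rexp ((L * C - b) / 2) * rexp (-(L * C / 2)) = rexp (-(b / 2)) := by
      rw [← Real.exp_add]
      ring_nf
    rw [← h1, ← hside]
    linear_combination (-(2 * a * rexp (-(L * C / 2)))) * hs
  have hedge' : rexp (1 - L * c * w) * d = rexp 1 * rexp (-(c * w - δ) * L) := by
    rw [hd, ← Real.exp_add, ← Real.exp_add]
    ring_nf
  have hcorner : rexp (-(L * C / 4)) * d ^ 2 = rexp (-(C / 4 - 2 * δ) * L) := by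
    rw [hd, ← Real.exp_nat_mul, ← Real.exp_add]
    push_cast
    ring_nf
  have hm4 : rexp (-(L * (4 * m))) ≤ rexp ε * rexp (-(L * C)) := by
    rw [← Real.exp_add, Real.exp_le_exp]
    linarith
  have hm2 : rexp (-(L * (2 * m))) ≤ rexp ε * rexp (-(L * C / 2)) := by
    rw [← Real.exp_add, Real.exp_le_exp]
    linarith
  have hm1 : rexp (-(L * m)) ≤ rexp ε * rexp (-(L * C / 4)) := by
    rw [← Real.exp_add, Real.exp_le_exp]
    linarith
  rw [Real.rpow_neg hL.le, ← Real.sqrt_eq_rpow]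
  simp only [setIntegral_centeredSquare_norm_sub hmono hrange ha]
  rw [setIntegral_centeredSquare a fun p => rexp (-(L * squareMass g a p.1 p.2))]
  calc _ ≤ L * ((2 * a) ^ 2 * (rexp ε * rexp (-(L * C))) +
        (rexp ε * rexp (-(L * C / 2))) *
          (4 * a * (2 / (L * c) + rexp (1 - L * c * w) * (2 * d))) +
        (rexp ε * rexp (-(L * C / 4))) * (rexp 1 * (2 * d)) ^ 2) := by
        refine mul_le_mul_of_nonneg_left
          ((setIntegral_exp_neg_squareMass_le hmono hrange hL hw hgt hwd hda).trans ?_) hL.le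
        gcongr
    _ = rexp ε * (L * (2 * a) ^ 2 * rexp (-(L * C)) +
        (4 * (L * (2 * a) * rexp (-(L * C / 2))) * (1 / (L * c) + rexp (1 - L * c * w) * d) +
        4 * rexp 1 ^ 2 * (L * (rexp (-(L * C / 4)) * d ^ 2)))) := by
        ring
    _ = _ := by
        rw [hinterior, hedge, hedge', hcorner]
        have : 1 / (L * c) = c⁻¹ * ((√L)⁻¹ * (√L)⁻¹) := by
          rw [← mul_inv, hs]
          field_simp
        rw [this]
        field_simp

/-- for non-increasing `g : [0,∞) → [0,1]` with
`0 < C := ∫_{ℝ²} g(‖x‖) dx < ∞` and `g(x) = o(1/(x² log² x))`, and `b ∈ ℝ`,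
`lim_{ρ→∞} λ_ρ ∫_{A_ρ} exp(−λ_ρ ∫_{A_ρ} g(‖x − y‖) dy) dx = e^{−b}`. -/
theorem expected_isolated_nodes_limit
    (g : ℝ → ℝ)
    (hmono : AntitoneOn g (Set.Ici (0 : ℝ)))
    (hrange : ∀ x ∈ Set.Ici (0 : ℝ), g x ∈ Set.Icc (0 : ℝ) 1)
    (hint : Integrable (fun x : EuclideanSpace ℝ (Fin 2) => g ‖x‖))
    (hpos : 0 < Cg g)
    (hlittleo : g =o[atTop] fun x : ℝ => 1 / (x ^ 2 * Real.log x ^ 2))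
    (b : ℝ) :
    Tendsto (fun ρ : ℝ =>
      lamDen g b ρ *
        ∫ x in sqA g b ρ,
          Real.exp (-(lamDen g b ρ * ∫ y in sqA g b ρ, g ‖x - y‖)))
      atTop (nhds (Real.exp (-b))) := by
  have hL : Tendsto (lamDen g b) atTop atTop :=
    (Real.tendsto_log_atTop.atTop_add tendsto_const_nhds).atTop_div_const hpos
  have hscale : ∀ᶠ ρ in atTop, 0 < lamDen g b ρ ∧
      (2 * (1 / (2 * rRho g b ρ))) ^ 2 = rexp (lamDen g b ρ * Cg g - b) / lamDen g b ρ := by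
    filter_upwards [eventually_gt_atTop 0, hL.eventually_gt_atTop 0] with ρ hρ hpos'
    have hr : rRho g b ρ = √(lamDen g b ρ / ρ) := by rw [rRho, lamDen, div_div]
    have hlog : lamDen g b ρ * Cg g - b = Real.log ρ := by
      rw [lamDen, div_mul_cancel₀ _ hpos.ne', add_sub_cancel_right]
    have hr2 : rRho g b ρ ^ 2 = lamDen g b ρ / ρ := by rw [hr, Real.sq_sqrt (by positivity)]
    refine ⟨hpos', ?_⟩
    rw [hlog, Real.exp_log hρ, ← inv_div (lamDen g b ρ) ρ, ← hr2, ← inv_pow]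
    congr 1
    rw [one_div, mul_inv, mul_inv_cancel_left₀ two_ne_zero]
  have hnonneg : ∀ ρ, 0 ≤ 1 / (2 * rRho g b ρ) := fun ρ =>
    one_div_nonneg.2 (mul_nonneg zero_le_two (Real.sqrt_nonneg _))
  refine tendsto_order.2 ⟨fun y hy => ?_, fun y hy => ?_⟩
  · filter_upwards [hscale] with ρ ⟨hpos', hsq⟩
    refine hy.trans_le ?_
    have := mul_exp_neg_le_setIntegral hmono hrange hint hpos'.le (hnonneg ρ)
    calc rexp (-b) = lamDen g b ρ * ((2 * (1 / (2 * rRho g b ρ))) ^ 2 *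
          rexp (-(lamDen g b ρ * Cg g))) := by
          rw [hsq, ← mul_assoc, mul_div_cancel₀ _ hpos'.ne', ← Real.exp_add]
          ring_nf
      _ ≤ _ := mul_le_mul_of_nonneg_left this hpos'.le
  · filter_upwards [hscale, hL.eventually
      (eventually_mul_setIntegral_lt hmono hrange hint hpos hlittleo b hy)] with ρ ⟨_, hsq⟩ h
    exact h _ (hnonneg ρ) hsq
end
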